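/- Let d ≥ 1 and let a_{ij} ∈ ℝ and c_{ij} > 2 (1 ≤ i, j ≤ d) be such that for every i there is some j with a_{ij} ≠ 0, and suppose there exists ε̂ > 0 such that for every choice of exponents c̃_{ij} ∈ [c_{ij} − ε̂, c_{ij} + ε̂] the fixed-point system s_i = min_{j : a_{ij} ≠ 0} ( c̃_{ij} − 2 + min(0, c̃_{ij} s_j − 1) ) (i = 1,…,d) has a solution (s_1,…,s_d) ∈ ℝ^d. Then there exists δ > 0 such that for all smooth spherically symmetric initial data (φ_i^{(0)}, φ_i^{(1)}) supported in {|x| < 1} ⊂ ℝ³ with ‖φ_i^{(0)}‖_{H²} + ‖φ_i^{(1)}‖_{H¹} ≤ δ for all i, the system □φ_i = ∑_{j=1}^d a_{ij} |φ_j|^{c_{ij}} has a global solution on [0,∞) × ℝ³: there exist continuous spherically symmetric functions φ_1, …, φ_d such that the functions ψ_i(t,r) = r·φ_i(t,r) satisfy the Duhamel integral equations ψ_i(t,r) = ψ_i^{lin}(t,r) + (1/2)∬_{D_{t,r}} r' · ∑_{j} a_{ij} |φ_j(t',r')|^{c_{ij}} dr' dt', where ψ_i^{lin} is the free radial wave evolution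 of the data; moreover there exist ε ∈ (0,1) and β_1, …, β_d ∈ ℝ such that sup_{t ≥ 0, x} ⟨v⟩^{1−ε} ⟨u⟩^{β_i} |φ_i(t,x)| < ∞ for every i, with u = (t−|x|)/2, v = (t+|x|)/2 and ⟨x⟩ = (1+x²)^{1/2}. -/

import Mathlib

open Real Set MeasureTheory

noncomputable section

/-- Three-dimensional Euclidean space. -/
abbrev E3 : Type := EuclideanSpace ℝ (Fin 3)

/-- A function on `ℝ³` is radial (spherically symmetric) if it depends only on `|x|`. -/
def Radial (f : E3 → ℝ) : Prop := ∀ x y : E3, ‖x‖ = ‖y‖ → f x = f y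

/-- Radial representative: value of `f` at the point at distance `r` on the first axis. -/
def radRep (f : E3 → ℝ) : ℝ → ℝ := fun r => f (r • EuclideanSpace.single (0 : Fin 3) (1 : ℝ))

/-- Japanese bracket `⟨x⟩ = (1 + x²)^{1/2}`. -/
def jap (x : ℝ) : ℝ := Real.sqrt (1 + x ^ 2)

/-- The `H¹` Sobolev norm on `ℝ³`. -/
def H1norm (f : E3 → ℝ) : ℝ :=
  ((∫ x : E3, (f x) ^ 2) + (∫ x : E3, ‖fderiv ℝ f x‖ ^ 2)) ^ ((1 : ℝ) / 2)

/-- The `H²` Sobolev norm on `ℝ³`. -/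
def H2norm (f : E3 → ℝ) : ℝ :=
  ((∫ x : E3, (f x) ^ 2) + (∫ x : E3, ‖fderiv ℝ f x‖ ^ 2)
    + (∫ x : E3, ‖fderiv ℝ (fderiv ℝ f) x‖ ^ 2)) ^ ((1 : ℝ) / 2)

/-- Free radial wave evolution of radial data `(f0, f1)` on `ℝ³`, written for
`ψ = r·φ` via d'Alembert's formula with the odd extensions `g(ρ) = ρ·f0(|ρ|)`,
`h(ρ) = ρ·f1(|ρ|)`. -/
def psiLin (f0 f1 : E3 → ℝ) : ℝ → ℝ → ℝ := fun t r =>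
  ((r + t) * radRep f0 (r + t) + (r - t) * radRep f0 (r - t)) / 2
    + (1 / 2) * ∫ ρ in (r - t)..(r + t), ρ * radRep f1 ρ

/-- The backward characteristic region `D_{t,r}` in the `(t', r')` quadrant. -/
def Dreg (t r : ℝ) : Set (ℝ × ℝ) :=
  {p | 0 ≤ p.1 ∧ p.1 ≤ t ∧ 0 ≤ p.2 ∧ t - r ≤ p.1 + p.2 ∧ p.1 + p.2 ≤ t + r ∧
    p.1 - p.2 ≤ t - r}

theorem exists_strict_exponents {d : ℕ} {P : Fin d → Fin d → Prop} {c : Fin d → Fin d → ℝ}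
    (hc : ∀ i j, 2 < c i j) {η₀ : ℝ} (hη₀ : 0 < η₀)
    (hpert : ∀ c' : Fin d → Fin d → ℝ, (∀ i j, |c' i j - c i j| ≤ η₀) →
      ∃ s : Fin d → ℝ, ∀ i j, P i j → s i ≤ c' i j - 2 + min 0 (c' i j * s j - 1)) :
    ∃ s : Fin d → ℝ, ∀ i j, P i j → s i < c i j - 2 ∧ s i < c i j - 3 + c i j * s j := by
  obtain ⟨η, hη, hη1, hη2⟩ : ∃ η : ℝ, 0 < η ∧ η ≤ η₀ ∧ ∀ i j, 2 < c i j - η := by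
    have h : ∀ᶠ η in nhdsWithin (0 : ℝ) (Set.Ioi 0), ∀ i j, 2 < c i j - η := by
      refine Filter.eventually_all.2 fun i => Filter.eventually_all.2 fun j => ?_
      filter_upwards [Ioo_mem_nhdsGT (sub_pos.2 (hc i j))] with η hη
      linarith [hη.2]
    obtain ⟨η, h1, h2⟩ := (h.and (Ioc_mem_nhdsGT hη₀)).exists
    exact ⟨η, h2.1, h2.2, h1⟩
  obtain ⟨s, hs⟩ := hpert (fun i j => c i j - η) fun i j => by
    rw [sub_sub_cancel_left, abs_neg, abs_of_pos hη]; exact hη1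
  have hs1 : ∀ i j, P i j → s i + 1 ≤ c i j - η - 1 := fun i j hij => by
    linarith [hs i j hij, min_le_left 0 ((c i j - η) * s j - 1)]
  have hs2 : ∀ i j, P i j → s i + 1 ≤ (c i j - η) * (s j + 1) - 2 := fun i j hij => by
    linarith [hs i j hij, min_le_right 0 ((c i j - η) * s j - 1)]
  obtain ⟨R, hR3, hR⟩ : ∃ R : ℝ, 3 ≤ R ∧ ∀ i j, c i j ≤ R := by
    have h : ∀ᶠ R in Filter.atTop, ∀ i j, c i j ≤ R :=
      Filter.eventually_all.2 fun i => Filter.eventually_all.2 fun j => Filter.eventually_ge_atTop _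
    obtain ⟨R, h1, h2⟩ := (h.and (Filter.eventually_ge_atTop 3)).exists
    exact ⟨R, h2, h1⟩
  have hpow : ∀ x : ℝ, 0 ≤ x → x + 1 ≤ R ^ x := fun x hx => by
    have h1 : Real.exp x ≤ R ^ x := by
      rw [Real.rpow_def_of_pos (by linarith)]
      apply Real.exp_le_exp.2
      have : 1 ≤ Real.log R := by
        rw [Real.le_log_iff_exp_le (by linarith)]
        linarith [Real.exp_one_lt_d9]
      nlinarith
    linarith [Real.add_one_le_exp x]
  let σ : Fin d → ℝ := fun i => if 0 < s i + 1 then s i + 1 else - R ^ (-(s i + 1))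
  have hσle : ∀ i, σ i ≤ s i + 1 := fun i => by
    by_cases h : 0 < s i + 1
    · simp [σ, h]
    · simp only [σ, h, if_false]
      linarith [hpow (-(s i + 1)) (by linarith)]
  refine ⟨fun i => σ i - 1, fun i j hij => ⟨by linarith [hσle i, hs1 i j hij], ?_⟩⟩
  suffices σ i < c i j * σ j - 2 by linarith
  have hc2 := hη2 i j
  have hsij := hs2 i j hij
  by_cases hj : 0 < s j + 1
  · have : σ j = s j + 1 := by simp [σ, hj]
    rw [this]
    nlinarith [hσle i]
  · have hi : ¬ 0 < s i + 1 := by nlinarith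
    simp only [σ, hi, hj, if_false]
    have h1 : R ^ ((2 : ℝ) + (-(s j + 1))) ≤ R ^ (-(s i + 1)) :=
      Real.rpow_le_rpow_of_exponent_le (by linarith) (by nlinarith)
    rw [Real.rpow_add (by linarith), Real.rpow_two] at h1
    have h2 := hpow (-(s j + 1)) (by linarith)
    have h3 : 1 ≤ R ^ (-(s j + 1)) := by linarith
    have h4 := hR i j
    have h5 : c i j * R ^ (-(s j + 1)) ≤ R * R ^ (-(s j + 1)) :=
      mul_le_mul_of_nonneg_right h4 (by linarith)
    nlinarith [mul_le_mul_of_nonneg_left h3 (by nlinarith : 0 ≤ R ^ 2 - R)]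

theorem lintegral_add_mul_sub {F G : ℝ → ENNReal} (hF : Measurable F) (hG : Measurable G) :
    ∫⁻ p : ℝ × ℝ, F (p.1 + p.2) * G (p.1 - p.2)
      = ENNReal.ofReal (1 / 2) * ((∫⁻ x, F x) * ∫⁻ x, G x) := by
  have hdbl : ∀ ξ : ℝ, ∫⁻ x : ℝ, G (2 * x - ξ) = ENNReal.ofReal (1 / 2) * ∫⁻ x, G x := fun ξ => by
    have h1 : ∫⁻ x : ℝ, G (2 * x - ξ) = ∫⁻ y, G (y - ξ) ∂(Measure.map (2 * ·) volume) := by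
      rw [lintegral_map (by fun_prop) (by fun_prop)]
    rw [h1, Real.map_volume_mul_left two_ne_zero, lintegral_smul_measure,
      lintegral_sub_right_eq_self (fun y => G y) ξ]
    norm_num
  rw [Measure.volume_eq_prod, lintegral_prod _ (by fun_prop)]
  calc ∫⁻ x, ∫⁻ y, F (x + y) * G (x - y)
      = ∫⁻ x, ∫⁻ ξ, F ξ * G (2 * x - ξ) := by
        refine lintegral_congr fun x => ?_
        rw [← lintegral_add_left_eq_self (fun ξ => F ξ * G (2 * x - ξ)) x]
        refine lintegral_congr fun y => ?_
        ring_nf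
    _ = ∫⁻ ξ, ∫⁻ x, F ξ * G (2 * x - ξ) := lintegral_lintegral_swap (by fun_prop)
    _ = ∫⁻ ξ, F ξ * (ENNReal.ofReal (1 / 2) * ∫⁻ x, G x) := by
        refine lintegral_congr fun ξ => ?_
        rw [lintegral_const_mul _ (by fun_prop), hdbl]
    _ = _ := by
        rw [lintegral_mul_const _ hF]; ring

/-- The solution `φ` of `□φ = S` with zero data, where `K t y = y * S t |y|`. -/
def duhamelMean (K : ℝ → ℝ → ℝ) (t r : ℝ) : ℝ :=
  (1 / 2) * (t * ∫ θ in (0 : ℝ)..1, ∫ s in (-1 : ℝ)..1, K (t * θ) ((t - t * θ) + r * s))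

theorem continuous_duhamelMean {K : ℝ → ℝ → ℝ} (hK : Continuous (Function.uncurry K)) :
    Continuous (fun p : ℝ × ℝ => duhamelMean K p.1 p.2) := by
  unfold duhamelMean
  refine continuous_const.mul (continuous_fst.mul ?_)
  refine intervalIntegral.continuous_parametric_intervalIntegral_of_continuous' ?_ _ _
  have := intervalIntegral.continuous_parametric_intervalIntegral_of_continuous'
    (f := fun (q : (ℝ × ℝ) × ℝ) (s : ℝ) =>
      K (q.1.1 * q.2) ((q.1.1 - q.1.1 * q.2) + q.1.2 * s)) (μ := volume) ?_ (-1) 1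
  · exact this
  · exact hK.comp (by fun_prop : Continuous fun z : ((ℝ × ℝ) × ℝ) × ℝ =>
      (z.1.1.1 * z.1.2, (z.1.1.1 - z.1.1.1 * z.1.2) + z.1.1.2 * z.2))

theorem integral_abs_left_of_odd {f : ℝ → ℝ} (hf : Continuous f) (hodd : ∀ y, f (-y) = -f y)
    (a b : ℝ) : ∫ y in |a|..b, f y = ∫ y in a..b, f y := by
  rcases le_or_gt 0 a with ha | ha
  · rw [abs_of_nonneg ha]
  · have h1 : ∫ y in a..(-a), f y = 0 := by
      have h2 := intervalIntegral.integral_comp_neg (a := a) (b := -a) f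
      simp only [hodd, intervalIntegral.integral_neg, neg_neg] at h2
      linarith
    rw [abs_of_neg ha, ← intervalIntegral.integral_add_adjacent_intervals
      (hf.intervalIntegrable a (-a)) (hf.intervalIntegrable (-a) b), h1, zero_add]

theorem isCompact_Dreg (t r : ℝ) : IsCompact (Dreg t r) := by
  refine Metric.isCompact_of_isClosed_isBounded ?_ ?_
  · have : Dreg t r = {p | 0 ≤ p.1} ∩ {p | p.1 ≤ t} ∩ {p | 0 ≤ p.2} ∩ {p | t - r ≤ p.1 + p.2} ∩
        {p | p.1 + p.2 ≤ t + r} ∩ {p | p.1 - p.2 ≤ t - r} := by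
      ext p; simp [Dreg, and_assoc]
    rw [this]
    refine ((((IsClosed.inter ?_ ?_).inter ?_).inter ?_).inter ?_).inter ?_ <;>
      exact isClosed_le (by fun_prop) (by fun_prop)
  · refine (Metric.isBounded_Icc ((0 : ℝ), (0 : ℝ)) (t, t + r)).subset ?_
    rintro ⟨x, y⟩ ⟨h1, h2, h3, h4, h5, h6⟩
    exact ⟨⟨h1, h3⟩, ⟨h2, by simp only at *; linarith⟩⟩

theorem integral_Dreg {f : ℝ × ℝ → ℝ} (hf : Continuous f) {t r : ℝ} (ht : 0 ≤ t) (hr : 0 ≤ r) :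
    ∫ p in Dreg t r, f p = ∫ x in (0 : ℝ)..t, ∫ y in |t - x - r|..(t - x + r), f (x, y) := by
  have hm := (isCompact_Dreg t r).measurableSet
  have hint : IntegrableOn f (Dreg t r) := hf.continuousOn.integrableOn_compact (isCompact_Dreg t r)
  rw [← integral_indicator hm, Measure.volume_eq_prod,
    integral_prod _ (by rw [← Measure.volume_eq_prod]; exact (integrable_indicator_iff hm).2 hint),
    intervalIntegral.integral_of_le ht, ← integral_Icc_eq_integral_Ioc,
    ← integral_indicator measurableSet_Icc]
  refine integral_congr_ae (Filter.Eventually.of_forall fun x => ?_)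
  by_cases hx : x ∈ Icc 0 t
  · have hle : |t - x - r| ≤ t - x + r := abs_le.2 ⟨by linarith [hx.2], by linarith⟩
    simp only [indicator_of_mem hx]
    rw [intervalIntegral.integral_of_le hle, ← integral_Icc_eq_integral_Ioc,
      ← integral_indicator measurableSet_Icc]
    refine integral_congr_ae (Filter.Eventually.of_forall fun y => ?_)
    have : (x, y) ∈ Dreg t r ↔ y ∈ Icc |t - x - r| (t - x + r) := by
      simp only [Dreg, mem_ofPred_eq, mem_Icc, abs_le]
      constructor
      · rintro ⟨h1, h2, h3, h4, h5, h6⟩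
        exact ⟨⟨by linarith, by linarith⟩, by linarith⟩
      · rintro ⟨⟨h1, h2⟩, h3⟩
        exact ⟨hx.1, hx.2, by linarith, by linarith, by linarith, by linarith⟩
    by_cases hy : (x, y) ∈ Dreg t r
    · simp only [indicator_of_mem hy, indicator_of_mem (this.1 hy)]
    · simp only [indicator_of_notMem hy, indicator_of_notMem (mt this.2 hy)]
  · simp only [indicator_of_notMem hx]
    rw [← integral_zero ℝ ℝ (μ := volume)]
    refine integral_congr_ae (Filter.Eventually.of_forall fun y => ?_)
    exact indicator_of_notMem (fun h => hx ⟨h.1, h.2.1⟩) _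

theorem mul_duhamelMean {K : ℝ → ℝ → ℝ} (hK : Continuous (Function.uncurry K))
    (hodd : ∀ t y, K t (-y) = -K t y) {t r : ℝ} (ht : 0 ≤ t) (hr : 0 ≤ r) :
    r * duhamelMean K t r = (1 / 2) * ∫ p in Dreg t r, K p.1 p.2 := by
  have hKt : ∀ x, Continuous (K x) := fun x => hK.comp (by fun_prop : Continuous fun y => (x, y))
  have h1 : t * ∫ θ in (0 : ℝ)..1, r * ∫ s in (-1 : ℝ)..1, K (t * θ) ((t - t * θ) + r * s)
      = ∫ x in (0 : ℝ)..t, r * ∫ s in (-1 : ℝ)..1, K x ((t - x) + r * s) := by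
    simpa using intervalIntegral.mul_integral_comp_mul_left (a := 0) (b := 1) t
      (f := fun x => r * ∫ s in (-1 : ℝ)..1, K x ((t - x) + r * s))
  rw [integral_Dreg (f := fun p => K p.1 p.2) hK ht hr]
  calc r * duhamelMean K t r
      = (1 / 2) * (t * ∫ θ in (0 : ℝ)..1,
          r * ∫ s in (-1 : ℝ)..1, K (t * θ) ((t - t * θ) + r * s)) := by
        rw [duhamelMean, intervalIntegral.integral_const_mul]; ring
    _ = _ := by
        rw [h1]
        congr 1
        refine intervalIntegral.integral_congr fun x _ => ?_
        simp only
        rw [integral_abs_left_of_odd (hKt x) (hodd x),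
          intervalIntegral.mul_integral_comp_add_mul]
        congr 1 <;> ring

theorem integral_rpow_one_sub_le {c U V : ℝ} (hc : 2 < c) (hU : 1 ≤ U) (hUV : U ≤ V) :
    ∫ x in U..V, x ^ (1 - c) ≤ (2 + 2 / (c - 2)) * ((V - U) * V⁻¹ * U ^ (2 - c)) := by
  have hU0 : 0 < U := by linarith
  have hV0 : 0 < V := by linarith
  have hP : 0 < U ^ (2 - c) := Real.rpow_pos_of_pos hU0 _
  have hc2 : 0 < c - 2 := by linarith
  have hA : 0 ≤ (V - U) * V⁻¹ * U ^ (2 - c) :=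
    mul_nonneg (mul_nonneg (by linarith) (inv_nonneg.2 hV0.le)) hP.le
  rcases le_or_gt V (2 * U) with h | h
  · have h1 : ∫ x in U..V, x ^ (1 - c) ≤ ∫ _ in U..V, U ^ (1 - c) := by
      refine intervalIntegral.integral_mono_on hUV ?_ (by simp) fun x hx => ?_
      · exact (ContinuousOn.rpow_const continuousOn_id fun x hx => Or.inl (by
          rw [uIcc_of_le hUV] at hx; simp only [id]; linarith [hx.1])).intervalIntegrable
      · exact Real.rpow_le_rpow_of_nonpos hU0 hx.1 (by linarith)
    have h2 : U ^ (2 - c) = U ^ (1 - c) * U := by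
      rw [← Real.rpow_add_one hU0.ne']; ring_nf
    have h3 : (V - U) * U ^ (1 - c) ≤ 2 * ((V - U) * V⁻¹ * U ^ (2 - c)) := by
      have h4 : 1 ≤ 2 * (V⁻¹ * U) := by
        rw [← mul_inv_cancel₀ hV0.ne']
        nlinarith [inv_pos.2 hV0]
      rw [h2]
      have h5 : 0 ≤ (V - U) * U ^ (1 - c) :=
        mul_nonneg (by linarith) (Real.rpow_nonneg hU0.le _)
      nlinarith [mul_le_mul_of_nonneg_left h4 h5]
    rw [intervalIntegral.integral_const, smul_eq_mul] at h1
    have h6 : 0 ≤ 2 / (c - 2) := by positivity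
    nlinarith [mul_nonneg h6 hA]
  · have h1 : ∫ x in U..V, x ^ (1 - c) ≤ U ^ (2 - c) / (c - 2) := by
      rw [integral_rpow (Or.inr ⟨by linarith, fun hx => by
        rw [uIcc_of_le hUV] at hx; linarith [hx.1]⟩)]
      have h2 : 1 - c + 1 = -(c - 2) := by ring
      have h3 : 0 ≤ V ^ (-(c - 2)) := Real.rpow_nonneg hV0.le _
      rw [h2, div_neg, ← neg_div, show 2 - c = -(c - 2) by ring]
      exact div_le_div_of_nonneg_right (by linarith) hc2.le
    have h2 : 1 ≤ 2 * ((V - U) * V⁻¹) := by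
      have : (V - U) * V⁻¹ = 1 - U * V⁻¹ := by field_simp
      rw [this]
      have : U * V⁻¹ ≤ 1 / 2 := by
        rw [← div_eq_mul_inv, div_le_iff₀ hV0]; linarith
      linarith
    have h3 : U ^ (2 - c) / (c - 2) ≤ 2 / (c - 2) * ((V - U) * V⁻¹ * U ^ (2 - c)) := by
      have h4 : 0 ≤ U ^ (2 - c) / (c - 2) := by positivity
      calc U ^ (2 - c) / (c - 2) ≤ U ^ (2 - c) / (c - 2) * (2 * ((V - U) * V⁻¹)) :=
            le_mul_of_one_le_right h4 h2
        _ = _ := by ring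
    linarith

theorem integral_rpow_neg_le {p m U : ℝ} (hm : 0 < m) (hp : -p ≤ m - 1) (hU : 1 ≤ U) :
    ∫ x in (1 : ℝ)..U, x ^ (-p) ≤ U ^ m / m := by
  have hi : ∀ q : ℝ, IntervalIntegrable (fun x : ℝ => x ^ q) volume 1 U := fun q =>
    (ContinuousOn.rpow_const continuousOn_id fun x hx => Or.inl (by
      rw [uIcc_of_le hU] at hx; simp only [id]; linarith [hx.1])).intervalIntegrable
  calc ∫ x in (1 : ℝ)..U, x ^ (-p) ≤ ∫ x in (1 : ℝ)..U, x ^ (m - 1) :=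
        intervalIntegral.integral_mono_on hU (hi _) (hi _) fun x hx =>
          Real.rpow_le_rpow_of_exponent_le hx.1 hp
    _ = (U ^ m - 1) / m := by
        rw [integral_rpow (Or.inl (by linarith))]; simp
    _ ≤ _ := by
        exact div_le_div_of_nonneg_right (by linarith) hm.le

theorem lintegral_indicator_Icc_ofReal {f : ℝ → ℝ} {a b : ℝ} (hab : a ≤ b)
    (hf : ContinuousOn f (Icc a b)) (h0 : ∀ x ∈ Icc a b, 0 ≤ f x) :
    ∫⁻ x, (Icc a b).indicator (fun x => ENNReal.ofReal (f x)) x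
      = ENNReal.ofReal (∫ x in a..b, f x) := by
  rw [lintegral_indicator measurableSet_Icc, intervalIntegral.integral_of_le hab,
    ← integral_Icc_eq_integral_Ioc, ofReal_integral_eq_lintegral_ofReal]
  · exact hf.integrableOn_compact isCompact_Icc
  · exact (ae_restrict_iff' measurableSet_Icc).2 (Filter.Eventually.of_forall h0)

theorem integral_Dreg_eq_zero {K : ℝ → ℝ → ℝ} (hsupp : ∀ t y, 0 ≤ t → t + 1 ≤ y → K t y = 0)
    {t r : ℝ} (htr : t + 1 ≤ r) : ∫ p in Dreg t r, K p.1 p.2 = 0 := by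
  refine setIntegral_eq_zero_of_forall_eq_zero fun p hp => ?_
  obtain ⟨h1, h2, h3, h4, h5, h6⟩ := hp
  exact hsupp _ _ h1 (by linarith)

theorem abs_integral_Dreg_le {K : ℝ → ℝ → ℝ} {B c p m : ℝ} (hc : 2 < c) (hm : 0 < m)
    (hp : -p ≤ m - 1) (hsupp : ∀ t y, 0 ≤ t → t + 1 ≤ y → K t y = 0) (hB : 0 ≤ B)
    (hbd : ∀ t y, 0 ≤ t → 0 ≤ y → y ≤ t + 1 →
      |K t y| ≤ B * ((2 + t + y) ^ (1 - c) * (2 + t - y) ^ (-p)))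
    {t r : ℝ} (hr : 0 ≤ r) (hrt : r ≤ t + 1) :
    |∫ p in Dreg t r, K p.1 p.2| ≤ B * ((1 / 2) * (((2 + 2 / (c - 2)) *
      (2 * r * (2 + t + r)⁻¹ * (2 + t - r) ^ (2 - c))) * ((2 + t - r) ^ m / m))) := by
  set F : ℝ → ENNReal :=
    (Icc (t - r) (t + r)).indicator (fun x => ENNReal.ofReal ((2 + x) ^ (1 - c))) with hF
  set G : ℝ → ENNReal :=
    (Icc (-1) (t - r)).indicator (fun x => ENNReal.ofReal ((2 + x) ^ (-p))) with hG
  have hFm : Measurable F := Measurable.indicator (by fun_prop) measurableSet_Icc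
  have hGm : Measurable G := Measurable.indicator (by fun_prop) measurableSet_Icc
  have hcont : ∀ (q a b : ℝ), -1 ≤ a → ContinuousOn (fun x : ℝ => (2 + x) ^ q) (Icc a b) :=
    fun q a b ha => ContinuousOn.rpow_const (by fun_prop) fun x hx =>
      Or.inl (by linarith [hx.1])
  have hnn : ∀ (q a b : ℝ), -1 ≤ a → ∀ x ∈ Icc a b, 0 ≤ (2 + x) ^ q :=
    fun q a b ha x hx => Real.rpow_nonneg (by linarith [hx.1]) _
  have hFi : ∫⁻ x, F x ≤ ENNReal.ofReal ((2 + 2 / (c - 2)) *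
      (2 * r * (2 + t + r)⁻¹ * (2 + t - r) ^ (2 - c))) := by
    rw [hF, lintegral_indicator_Icc_ofReal (by linarith) (hcont _ _ _ (by linarith))
      (hnn _ _ _ (by linarith))]
    refine ENNReal.ofReal_le_ofReal ?_
    have h1 := integral_rpow_one_sub_le (c := c) (U := 2 + t - r) (V := 2 + t + r) hc
      (by linarith) (by linarith)
    rw [intervalIntegral.integral_comp_add_left (fun x => x ^ (1 - c))]
    rw [show 2 + (t - r) = 2 + t - r by ring, show 2 + (t + r) = 2 + t + r by ring]
    refine h1.trans (le_of_eq ?_)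
    ring
  have hGi : ∫⁻ x, G x ≤ ENNReal.ofReal ((2 + t - r) ^ m / m) := by
    rw [hG, lintegral_indicator_Icc_ofReal (by linarith) (hcont _ _ _ le_rfl)
      (hnn _ _ _ le_rfl)]
    refine ENNReal.ofReal_le_ofReal ?_
    rw [intervalIntegral.integral_comp_add_left (fun x => x ^ (-p))]
    rw [show 2 + (t - r) = 2 + t - r by ring, show (2 : ℝ) + -1 = 1 by norm_num]
    exact integral_rpow_neg_le hm hp (by linarith)
  have hm' := (isCompact_Dreg t r).measurableSet
  have hpt : ∀ p ∈ Dreg t r, ‖K p.1 p.2‖ₑ ≤ ENNReal.ofReal B * (F (p.1 + p.2) * G (p.1 - p.2)) := by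
    rintro ⟨x, y⟩ ⟨h1, h2, h3, h4, h5, h6⟩
    simp only at *
    rcases le_or_gt (x + 1) y with hy | hy
    · simp [hsupp x y h1 hy]
    · have e1 : x + y ∈ Icc (t - r) (t + r) := ⟨h4, h5⟩
      have e2 : x - y ∈ Icc (-1) (t - r) := ⟨by linarith, h6⟩
      rw [hF, hG, indicator_of_mem e1, indicator_of_mem e2,
        ← ENNReal.ofReal_mul (Real.rpow_nonneg (by linarith) _), ← ENNReal.ofReal_mul hB,
        Real.enorm_eq_ofReal_abs]
      refine ENNReal.ofReal_le_ofReal ?_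
      have := hbd x y h1 h3 hy.le
      rwa [show 2 + (x + y) = 2 + x + y by ring, show 2 + (x - y) = 2 + x - y by ring]
  have hE1 : 0 ≤ (2 + 2 / (c - 2)) * (2 * r * (2 + t + r)⁻¹ * (2 + t - r) ^ (2 - c)) := by
    have : 0 < c - 2 := by linarith
    have : 0 ≤ (2 + t + r)⁻¹ := inv_nonneg.2 (by linarith)
    have : 0 ≤ (2 + t - r) ^ (2 - c) := Real.rpow_nonneg (by linarith) _
    positivity
  have hE2 : 0 ≤ (2 + t - r) ^ m / m := div_nonneg (Real.rpow_nonneg (by linarith) _) hm.le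
  have key : ‖∫ p in Dreg t r, K p.1 p.2‖ₑ ≤ ENNReal.ofReal (B * ((1 / 2) * (((2 + 2 / (c - 2)) *
      (2 * r * (2 + t + r)⁻¹ * (2 + t - r) ^ (2 - c))) * ((2 + t - r) ^ m / m)))) := by
    calc ‖∫ p in Dreg t r, K p.1 p.2‖ₑ ≤ ∫⁻ p in Dreg t r, ‖K p.1 p.2‖ₑ :=
          enorm_integral_le_lintegral_enorm _
      _ ≤ ∫⁻ p in Dreg t r, ENNReal.ofReal B * (F (p.1 + p.2) * G (p.1 - p.2)) :=
          setLIntegral_mono' hm' hpt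
      _ ≤ ∫⁻ p : ℝ × ℝ, ENNReal.ofReal B * (F (p.1 + p.2) * G (p.1 - p.2)) :=
          setLIntegral_le_lintegral _ _
      _ = ENNReal.ofReal B * (ENNReal.ofReal (1 / 2) * ((∫⁻ x, F x) * ∫⁻ x, G x)) := by
          rw [lintegral_const_mul _ (by fun_prop), lintegral_add_mul_sub hFm hGm]
      _ ≤ _ := by
          rw [ENNReal.ofReal_mul hB, ENNReal.ofReal_mul (by norm_num : (0 : ℝ) ≤ 1 / 2),
            ENNReal.ofReal_mul hE1]
          gcongr
  rw [Real.enorm_eq_ofReal_abs] at key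
  refine (ENNReal.ofReal_le_ofReal_iff ?_).1 key
  positivity

theorem abs_abs_rpow_sub_abs_rpow_le {c M x y : ℝ} (hc : 1 ≤ c) (hx : |x| ≤ M) (hy : |y| ≤ M) :
    |(|x| ^ c - |y| ^ c)| ≤ c * M ^ (c - 1) * |x - y| := by
  have h := Convex.norm_image_sub_le_of_norm_hasDerivWithin_le (f := fun z : ℝ => z ^ c)
    (f' := fun z => c * z ^ (c - 1)) (s := Icc 0 M) (C := c * M ^ (c - 1)) (x := |y|) (y := |x|)
    (fun z _ => (Real.hasDerivAt_rpow_const (Or.inr hc)).hasDerivWithinAt)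
    (fun z hz => by
      rw [Real.norm_eq_abs, abs_of_nonneg (mul_nonneg (by linarith) (Real.rpow_nonneg hz.1 _))]
      exact mul_le_mul_of_nonneg_left
        (Real.rpow_le_rpow hz.1 hz.2 (by linarith)) (by linarith))
    (convex_Icc 0 M) ⟨abs_nonneg y, hy⟩ ⟨abs_nonneg x, hx⟩
  simp only [Real.norm_eq_abs] at h
  refine h.trans (mul_le_mul_of_nonneg_left (abs_abs_sub_abs_le_abs_sub x y) ?_)
  exact mul_nonneg (by linarith) (Real.rpow_nonneg ((abs_nonneg x).trans hx) _)

theorem duhamelMean_sub {K₁ K₂ : ℝ → ℝ → ℝ} (h₁ : Continuous (Function.uncurry K₁))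
    (h₂ : Continuous (Function.uncurry K₂)) (t r : ℝ) :
    duhamelMean (fun t y => K₁ t y - K₂ t y) t r = duhamelMean K₁ t r - duhamelMean K₂ t r := by
  have hin : ∀ {K : ℝ → ℝ → ℝ}, Continuous (Function.uncurry K) → ∀ θ : ℝ,
      IntervalIntegrable (fun s => K (t * θ) ((t - t * θ) + r * s)) volume (-1) 1 :=
    fun hK θ => (hK.comp (by fun_prop : Continuous fun s : ℝ =>
      (t * θ, (t - t * θ) + r * s))).intervalIntegrable _ _
  have hout : ∀ {K : ℝ → ℝ → ℝ}, Continuous (Function.uncurry K) →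
      IntervalIntegrable (fun θ => ∫ s in (-1 : ℝ)..1, K (t * θ) ((t - t * θ) + r * s))
        volume 0 1 := fun {K} hK =>
    (intervalIntegral.continuous_parametric_intervalIntegral_of_continuous'
      (f := fun θ s => K (t * θ) ((t - t * θ) + r * s))
      (hK.comp (by fun_prop : Continuous fun z : ℝ × ℝ =>
        (t * z.1, (t - t * z.1) + r * z.2))) (-1) 1).intervalIntegrable _ _
  unfold duhamelMean
  have h : ∀ θ : ℝ, ∫ s in (-1 : ℝ)..1,
      (K₁ (t * θ) ((t - t * θ) + r * s) - K₂ (t * θ) ((t - t * θ) + r * s))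
      = (∫ s in (-1 : ℝ)..1, K₁ (t * θ) ((t - t * θ) + r * s))
        - ∫ s in (-1 : ℝ)..1, K₂ (t * θ) ((t - t * θ) + r * s) := fun θ =>
    intervalIntegral.integral_sub (hin h₁ θ) (hin h₂ θ)
  simp only [h]
  rw [intervalIntegral.integral_sub (hout h₁) (hout h₂)]
  ring

/-- The weight `⟨v⟩⁻¹ ⟨u⟩^{-s}`, up to constants, in the region `|r| ≤ |t| + 1`. -/
def weight (s t r : ℝ) : ℝ := (2 + |t| + |r|)⁻¹ * (max 1 (2 + |t| - |r|)) ^ (-s)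

theorem weight_pos (s t r : ℝ) : 0 < weight s t r :=
  mul_pos (inv_pos.2 (by positivity)) (Real.rpow_pos_of_pos (by positivity) _)

theorem continuous_weight (s : ℝ) : Continuous (fun p : ℝ × ℝ => weight s p.1 p.2) := by
  unfold weight
  refine Continuous.mul (Continuous.inv₀ (by fun_prop) fun p => by positivity) ?_
  exact Continuous.rpow_const (by fun_prop) fun p =>
    Or.inl (by positivity)

theorem weight_of_le {s t r : ℝ} (ht : 0 ≤ t) (hr : 0 ≤ r) (hrt : r ≤ t + 1) :
    weight s t r = (2 + t + r)⁻¹ * (2 + t - r) ^ (-s) := by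
  rw [weight, abs_of_nonneg ht, abs_of_nonneg hr, max_eq_right (by linarith)]

theorem mul_weight_rpow_le {s t r c : ℝ} (ht : 0 ≤ t) (hr : 0 ≤ r) (hrt : r ≤ t + 1) :
    r * weight s t r ^ c ≤ (2 + t + r) ^ (1 - c) * (2 + t - r) ^ (-(c * s)) := by
  have hV : 0 < 2 + t + r := by linarith
  have hU : 0 < 2 + t - r := by linarith
  rw [weight_of_le ht hr hrt, Real.mul_rpow (inv_nonneg.2 hV.le) (Real.rpow_nonneg hU.le _),
    ← Real.rpow_mul hU.le, show -s * c = -(c * s) by ring, ← mul_assoc,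
    Real.inv_rpow hV.le, ← Real.rpow_neg hV.le]
  refine mul_le_mul_of_nonneg_right ?_ (Real.rpow_nonneg hU.le _)
  rw [show 1 - c = -c + 1 by ring, Real.rpow_add_one hV.ne', mul_comm]
  exact mul_le_mul_of_nonneg_left (by linarith) (Real.rpow_nonneg hV.le _)

theorem duhamelMean_eq_zero {K : ℝ → ℝ → ℝ} (hK : Continuous (Function.uncurry K))
    (hodd : ∀ t y, K t (-y) = -K t y) (hsupp : ∀ t y, 0 ≤ t → t + 1 ≤ y → K t y = 0)
    {t r : ℝ} (ht : 0 ≤ t) (htr : t + 1 ≤ r) : duhamelMean K t r = 0 := by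
  have h := mul_duhamelMean hK hodd ht (by linarith : 0 ≤ r)
  rw [integral_Dreg_eq_zero hsupp htr, mul_zero] at h
  exact (mul_eq_zero.1 h).resolve_left (by linarith)

theorem abs_duhamelMean_le {K : ℝ → ℝ → ℝ} {B c s σ : ℝ} (hc : 2 < c) (h₁ : s < c - 2)
    (h₂ : s < c - 3 + c * σ) (hK : Continuous (Function.uncurry K))
    (hodd : ∀ t y, K t (-y) = -K t y) (hsupp : ∀ t y, 0 ≤ t → t + 1 ≤ y → K t y = 0)
    (hB : 0 ≤ B)
    (hbd : ∀ t y, 0 ≤ t → 0 ≤ y → |K t y| ≤ B * (y * weight σ t y ^ c)) {t r : ℝ}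
    (ht : 0 ≤ t) (hr : 0 ≤ r) :
    |duhamelMean K t r| ≤ B * ((1 + 1 / (c - 2)) / (c - 2 - s)) * weight s t r := by
  have hm : 0 < c - 2 - s := by linarith
  have hc2 : 0 < c - 2 := by linarith
  have hpos : ∀ r : ℝ, 0 < r →
      |duhamelMean K t r| ≤ B * ((1 + 1 / (c - 2)) / (c - 2 - s)) * weight s t r := fun r hr => by
    rcases le_or_gt (t + 1) r with htr | htr
    · rw [duhamelMean_eq_zero hK hodd hsupp ht htr, abs_zero]
      have := (weight_pos s t r).le
      positivity
    · have h := abs_integral_Dreg_le (p := c * σ) hc hm (by linarith) hsupp hB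
        (fun t y ht hy hyt => (hbd t y ht hy).trans
          (mul_le_mul_of_nonneg_left (mul_weight_rpow_le ht hy hyt) hB)) hr.le htr.le
      have hU : 0 < 2 + t - r := by linarith
      have hV : 0 < 2 + t + r := by linarith
      have e := mul_duhamelMean hK hodd ht hr.le
      have e2 : |duhamelMean K t r| = r⁻¹ * ((1 / 2) * |∫ p in Dreg t r, K p.1 p.2|) := by
        have e4 := congrArg abs e
        rw [abs_mul, abs_mul, abs_of_pos hr, abs_of_pos (by norm_num : (0 : ℝ) < 1 / 2)] at e4
        rw [← e4, inv_mul_cancel_left₀ hr.ne']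
      rw [e2, weight_of_le ht hr.le htr.le]
      have e3 : (2 + t - r) ^ (-s) = (2 + t - r) ^ (2 - c) * (2 + t - r) ^ (c - 2 - s) := by
        rw [← Real.rpow_add hU]; ring_nf
      rw [e3]
      calc r⁻¹ * ((1 / 2) * |∫ p in Dreg t r, K p.1 p.2|)
          ≤ r⁻¹ * ((1 / 2) * (B * ((1 / 2) * (((2 + 2 / (c - 2)) *
            (2 * r * (2 + t + r)⁻¹ * (2 + t - r) ^ (2 - c))) *
              ((2 + t - r) ^ (c - 2 - s) / (c - 2 - s)))))) := by gcongr
        _ = _ := by field_simp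
  rcases hr.eq_or_lt with rfl | hr
  · have hcl : IsClosed {r : ℝ | |duhamelMean K t r|
        ≤ B * ((1 + 1 / (c - 2)) / (c - 2 - s)) * weight s t r} :=
      isClosed_le
        ((continuous_duhamelMean hK).comp (by fun_prop : Continuous fun r : ℝ => (t, r))).abs
        (continuous_const.mul
          ((continuous_weight s).comp (by fun_prop : Continuous fun r : ℝ => (t, r))))
    have h0 : (0 : ℝ) ∈ closure (Ioi (0 : ℝ)) := by rw [closure_Ioi]; exact self_mem_Ici
    exact hcl.closure_subset_iff.2 (fun r hr => hpos r hr) h0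
  · exact hpos r hr

theorem abs_le_of_integral_sq_deriv_le {f : ℝ → ℝ} {k : ℝ} (hk : 0 < k) (hf : ContDiff ℝ 1 f)
    (hsupp : ∀ y, 1 ≤ |y| → f y = 0) (hint : ∫ y in Ioi (0 : ℝ), y ^ 2 * (deriv f y) ^ 2 ≤ k ^ 2)
    {r : ℝ} (hr : 0 < r) : |f r| ≤ k / √r := by
  have hs : 0 < √r := Real.sqrt_pos.2 hr
  rcases le_or_gt 1 r with h1 | h1
  · rw [hsupp r (by rwa [abs_of_pos hr]), abs_zero]; positivity
  have hd : Continuous (deriv f) := hf.continuous_deriv le_rfl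
  have hcs : HasCompactSupport f := by
    refine HasCompactSupport.intro (isCompact_Icc (a := -1) (b := 1)) fun y hy => hsupp y ?_
    by_contra hlt
    exact hy (abs_le.1 (not_le.1 hlt).le)
  have hi : Integrable (fun y => y ^ 2 * (deriv f y) ^ 2) := by
    refine Continuous.integrable_of_hasCompactSupport (by fun_prop) ?_
    refine hcs.deriv.mono fun y hy => ?_
    simp only [Function.mem_support] at hy ⊢
    intro h; simp [h] at hy
  have hle : ∫ y in r..1, y ^ 2 * (deriv f y) ^ 2 ≤ k ^ 2 := by
    rw [intervalIntegral.integral_of_le h1.le]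
    refine le_trans (setIntegral_mono_set hi.integrableOn
      (Filter.Eventually.of_forall fun y => by positivity)
      (LE.le.eventuallyLE fun y hy => ?_)) hint
    exact hr.trans hy.1
  have hne : ∀ y ∈ uIcc r 1, y ≠ 0 := fun y hy => by
    rw [uIcc_of_le h1.le] at hy; linarith [hy.1]
  have hinv : ∫ y in r..1, (y ^ 2)⁻¹ = 1 / r - 1 := by
    have h2 : ∀ y ∈ uIcc r 1, HasDerivAt (fun y : ℝ => -y⁻¹) ((y ^ 2)⁻¹) y := fun y hy => by
      simpa using (hasDerivAt_inv (hne y hy)).fun_neg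
    rw [intervalIntegral.integral_eq_sub_of_hasDerivAt h2]
    · simp; ring
    · exact (ContinuousOn.inv₀ (by fun_prop) fun y hy =>
        pow_ne_zero 2 (hne y hy)).intervalIntegrable
  have hi1 : IntervalIntegrable (fun y => (1 / (2 * k * √r)) * (y ^ 2 * (deriv f y) ^ 2))
      volume r 1 := Continuous.intervalIntegrable (by fun_prop) _ _
  have hi2 : IntervalIntegrable (fun y => (k * √r / 2) * (y ^ 2)⁻¹) volume r 1 :=
    (continuousOn_const.mul (ContinuousOn.inv₀ (by fun_prop) fun y hy =>
        pow_ne_zero 2 (hne y hy))).intervalIntegrable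
  have hftc : ∫ y in r..1, deriv f y = - f r := by
    rw [intervalIntegral.integral_deriv_eq_sub (fun y _ => hf.differentiable one_ne_zero y)
      (hd.intervalIntegrable _ _), hsupp 1 (by simp), zero_sub]
  calc |f r| = |∫ y in r..1, deriv f y| := by rw [hftc, abs_neg]
    _ ≤ ∫ y in r..1, |deriv f y| := intervalIntegral.abs_integral_le_integral_abs h1.le
    _ ≤ ∫ y in r..1, ((1 / (2 * k * √r)) * (y ^ 2 * (deriv f y) ^ 2)
          + (k * √r / 2) * (y ^ 2)⁻¹) := by
        refine intervalIntegral.integral_mono_on h1.le (hd.abs.intervalIntegrable _ _)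
          (hi1.add hi2) fun y hy => ?_
        have hy0 : 0 < y := hr.trans_le hy.1
        have e : (1 / (2 * k * √r)) * (y ^ 2 * (deriv f y) ^ 2) + (k * √r / 2) * (y ^ 2)⁻¹
            - |deriv f y| = (1 / (2 * k * √r)) * (y * |deriv f y| - k * √r * y⁻¹) ^ 2 := by
          rw [← sq_abs (deriv f y)]
          field_simp
          ring
        have : 0 ≤ (1 / (2 * k * √r)) * (y * |deriv f y| - k * √r * y⁻¹) ^ 2 := by positivity
        linarith
    _ = (1 / (2 * k * √r)) * (∫ y in r..1, y ^ 2 * (deriv f y) ^ 2)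
          + (k * √r / 2) * (1 / r - 1) := by
        rw [intervalIntegral.integral_add hi1 hi2, intervalIntegral.integral_const_mul,
          intervalIntegral.integral_const_mul, hinv]
    _ ≤ (1 / (2 * k * √r)) * k ^ 2 + (k * √r / 2) * (1 / r) := by
        have := mul_le_mul_of_nonneg_left hle (by positivity : 0 ≤ 1 / (2 * k * √r))
        have : 0 ≤ k * √r / 2 := by positivity
        nlinarith
    _ = k / √r := by
        have : r = √r * √r := (Real.mul_self_sqrt hr.le).symm
        have e : √r / r = 1 / √r := by
          rw [eq_div_iff hs.ne', div_mul_eq_mul_div, div_eq_one_iff_eq hr.ne', ← this]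
        have e2 : (k * √r / 2) * (1 / r) = k / 2 * (√r / r) := by ring
        rw [e2, e]
        field_simp
        norm_num

theorem abs_le_of_abs_deriv_le_div_sqrt {f : ℝ → ℝ} {k : ℝ} (hk : 0 ≤ k) (hf : ContDiff ℝ 1 f)
    (hsupp : ∀ y, 1 ≤ |y| → f y = 0) (hd : ∀ y, 0 < y → |deriv f y| ≤ k / √y)
    {r : ℝ} (hr : 0 < r) : |f r| ≤ 2 * k := by
  rcases le_or_gt 1 r with h1 | h1
  · rw [hsupp r (by rwa [abs_of_pos hr]), abs_zero]; positivity
  have hdc : Continuous (deriv f) := hf.continuous_deriv le_rfl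
  have hpos : ∀ y ∈ uIcc r 1, 0 < y := fun y hy => by
    rw [uIcc_of_le h1.le] at hy; linarith [hy.1]
  have hi : IntervalIntegrable (fun y => k / √y) volume r 1 :=
    (continuousOn_const.div (by fun_prop) fun y hy =>
      (Real.sqrt_pos.2 (hpos y hy)).ne').intervalIntegrable
  have hftc : ∫ y in r..1, deriv f y = - f r := by
    rw [intervalIntegral.integral_deriv_eq_sub (fun y _ => hf.differentiable one_ne_zero y)
      (hdc.intervalIntegrable _ _), hsupp 1 (by simp), zero_sub]
  have hval : ∫ y in r..1, k / √y = 2 * k * √1 - 2 * k * √r := by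
    refine intervalIntegral.integral_eq_sub_of_hasDerivAt (f := fun y => 2 * k * √y)
      (fun y hy => ?_) hi
    refine ((Real.hasDerivAt_sqrt (hpos y hy).ne').const_mul (2 * k)).congr_deriv ?_
    have := (Real.sqrt_pos.2 (hpos y hy)).ne'
    field_simp
  calc |f r| = |∫ y in r..1, deriv f y| := by rw [hftc, abs_neg]
    _ ≤ ∫ y in r..1, |deriv f y| := intervalIntegral.abs_integral_le_integral_abs h1.le
    _ ≤ ∫ y in r..1, k / √y := intervalIntegral.integral_mono_on h1.le
        (hdc.abs.intervalIntegrable _ _) hi fun y hy => hd y (hr.trans_le hy.1)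
    _ ≤ 2 * k := by
        rw [hval, Real.sqrt_one]
        have : 0 ≤ 2 * k * √r := by positivity
        linarith

theorem Radial.radRep_eq {f : E3 → ℝ} (hf : Radial f) {e : E3} (he : ‖e‖ = 1) (r : ℝ) :
    radRep f r = f (r • e) :=
  hf _ _ (by simp [norm_smul, he])

theorem Radial.radRep_neg {f : E3 → ℝ} (hf : Radial f) (r : ℝ) : radRep f (-r) = radRep f r :=
  hf _ _ (by simp)

theorem contDiff_radRep {n : WithTop ℕ∞} {f : E3 → ℝ} (hf : ContDiff ℝ n f) :
    ContDiff ℝ n (radRep f) :=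
  hf.comp (contDiff_id.smul contDiff_const)

theorem radRep_eq_zero {f : E3 → ℝ} (hf : ∀ x, 1 ≤ ‖x‖ → f x = 0) {r : ℝ} (hr : 1 ≤ |r|) :
    radRep f r = 0 :=
  hf _ (by simpa [norm_smul] using hr)

theorem exists_unit_smul (x : E3) : ∃ e : E3, ‖e‖ = 1 ∧ x = ‖x‖ • e := by
  by_cases hx : x = 0
  · exact ⟨EuclideanSpace.single 0 1, by simp, by simp [hx]⟩
  · have : ‖x‖ ≠ 0 := norm_ne_zero_iff.2 hx
    exact ⟨‖x‖⁻¹ • x, by simp [norm_smul, this], by simp [smul_smul, this]⟩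

theorem Radial.hasDerivAt_radRep {f : E3 → ℝ} (hf : Radial f) (hd : Differentiable ℝ f) {e : E3}
    (he : ‖e‖ = 1) (r : ℝ) : HasDerivAt (radRep f) (fderiv ℝ f (r • e) e) r := by
  have h1 : radRep f = fun r : ℝ => f (r • e) := funext (hf.radRep_eq he)
  rw [h1]
  have h2 : HasDerivAt (fun r : ℝ => r • e) e r := by
    simpa using (hasDerivAt_id r).smul_const e
  exact (hd (r • e)).hasFDerivAt.comp_hasDerivAt r h2

theorem Radial.abs_deriv_radRep_le {f : E3 → ℝ} (hf : Radial f) (hd : Differentiable ℝ f)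
    (x : E3) : |deriv (radRep f) ‖x‖| ≤ ‖fderiv ℝ f x‖ := by
  obtain ⟨e, he, hx⟩ := exists_unit_smul x
  rw [(hf.hasDerivAt_radRep hd he ‖x‖).deriv, ← hx]
  simpa [he] using (fderiv ℝ f x).le_opNorm e

theorem Radial.abs_deriv_deriv_radRep_le {f : E3 → ℝ} (hf : Radial f) (hd : ContDiff ℝ 2 f)
    (x : E3) : |deriv (deriv (radRep f)) ‖x‖| ≤ ‖fderiv ℝ (fderiv ℝ f) x‖ := by
  obtain ⟨e, he, hx⟩ := exists_unit_smul x
  have hd1 : Differentiable ℝ f := hd.differentiable two_ne_zero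
  have hd2 : Differentiable ℝ (fderiv ℝ f) :=
    (hd.fderiv_right (m := 1) (by norm_num)).differentiable one_ne_zero
  have h1 : deriv (radRep f) = fun r : ℝ => fderiv ℝ f (r • e) e :=
    funext fun r => (hf.hasDerivAt_radRep hd1 he r).deriv
  have h2 : HasDerivAt (fun r : ℝ => r • e) e ‖x‖ := by
    simpa using (hasDerivAt_id ‖x‖).smul_const e
  have h3 : HasDerivAt (fun r : ℝ => fderiv ℝ f (r • e) e)
      (fderiv ℝ (fderiv ℝ f) (‖x‖ • e) e e) ‖x‖ := by
    have h4 : HasDerivAt (fun r : ℝ => fderiv ℝ f (r • e))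
        (fderiv ℝ (fderiv ℝ f) (‖x‖ • e) e) ‖x‖ :=
      (hd2 (‖x‖ • e)).hasFDerivAt.comp_hasDerivAt ‖x‖ h2
    exact ((ContinuousLinearMap.apply ℝ ℝ e).hasFDerivAt.comp_hasDerivAt ‖x‖ h4)
  rw [h1, h3.deriv, ← hx]
  have h4 := (fderiv ℝ (fderiv ℝ f) x e).le_opNorm e
  have h5 := (fderiv ℝ (fderiv ℝ f) x).le_opNorm e
  rw [he, mul_one] at h4 h5
  exact h4.trans h5

/-- The area of the unit sphere in `ℝ³`. -/
def sphereArea : ℝ := 3 * (volume : Measure E3).real (Metric.ball 0 1)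

theorem sphereArea_pos : 0 < sphereArea :=
  mul_pos three_pos (ENNReal.toReal_pos (Metric.measure_ball_pos volume (0 : E3) one_pos).ne'
    measure_ball_lt_top.ne)

theorem integral_sq_mul_le {q : ℝ → ℝ} {g : E3 → ℝ} {k : ℝ} (hg : Continuous g)
    (hgs : HasCompactSupport g) (hq : ∀ x, |q ‖x‖| ≤ g x) (hk : ∫ x, g x ^ 2 ≤ k ^ 2) :
    ∫ y in Ioi (0 : ℝ), y ^ 2 * q y ^ 2 ≤ (k / √sphereArea) ^ 2 := by
  have h1 := integral_fun_norm_addHaar (volume : Measure E3) (fun y => q y ^ 2)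
  have h2 : ∫ x : E3, q ‖x‖ ^ 2 ≤ ∫ x, g x ^ 2 := by
    refine integral_mono_of_nonneg (Filter.Eventually.of_forall fun x => sq_nonneg _) ?_
      (Filter.Eventually.of_forall fun x => ?_)
    · refine Continuous.integrable_of_hasCompactSupport (by fun_prop) (hgs.mono fun y hy => ?_)
      simp only [Function.mem_support] at hy ⊢
      intro h; simp [h] at hy
    · exact sq_le_sq' (by linarith [abs_le.1 (hq x)]) (abs_le.1 (hq x)).2
  rw [h1] at h2
  simp only [finrank_euclideanSpace, Fintype.card_fin, nsmul_eq_mul, smul_eq_mul,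
    Nat.cast_ofNat, ← mul_assoc, Nat.add_one_sub_one] at h2
  rw [div_pow, Real.sq_sqrt sphereArea_pos.le, le_div_iff₀ sphereArea_pos, mul_comm]
  exact h2.trans hk

/-- `g' + h` for the odd extensions `g`, `h` of `r * f0`, `r * f1`. -/
def linProfile (f0 f1 : E3 → ℝ) (y : ℝ) : ℝ :=
  deriv (fun y => y * radRep f0 y) y + y * radRep f1 y

/-- The free radial wave evolution `φ`, continuous up to `r = 0`. -/
def linMean (f0 f1 : E3 → ℝ) (t r : ℝ) : ℝ :=
  (1 / 2) * ∫ s in (-1 : ℝ)..1, linProfile f0 f1 (t + r * s)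

section Linear

variable {f0 f1 : E3 → ℝ}

theorem hasDerivAt_mul_radRep (h0 : ContDiff ℝ 1 f0) (y : ℝ) :
    HasDerivAt (fun y => y * radRep f0 y) (radRep f0 y + y * deriv (radRep f0) y) y := by
  have h := ((contDiff_radRep h0).differentiable one_ne_zero y).hasDerivAt
  simpa using (hasDerivAt_id y).fun_mul h

theorem linProfile_eq (h0 : ContDiff ℝ 1 f0) (y : ℝ) :
    linProfile f0 f1 y = radRep f0 y + y * deriv (radRep f0) y + y * radRep f1 y := by
  rw [linProfile, (hasDerivAt_mul_radRep h0 y).deriv]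

theorem continuous_linProfile (h0 : ContDiff ℝ 1 f0) (h1 : Continuous f1) :
    Continuous (linProfile f0 f1) := by
  have e0 : Continuous (radRep f0) := (contDiff_radRep h0).continuous
  have e1 : Continuous (deriv (radRep f0)) := (contDiff_radRep h0).continuous_deriv le_rfl
  have e2 : Continuous (radRep f1) := (contDiff_radRep (contDiff_zero.2 h1)).continuous
  rw [funext (linProfile_eq (f1 := f1) h0)]
  fun_prop

theorem linProfile_eq_zero (h0 : ContDiff ℝ 1 f0) (h1 : Continuous f1)
    (z0 : ∀ x, 1 ≤ ‖x‖ → f0 x = 0) (z1 : ∀ x, 1 ≤ ‖x‖ → f1 x = 0) {y : ℝ} (hy : 1 ≤ |y|) :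
    linProfile f0 f1 y = 0 := by
  have hcl : IsClosed {y : ℝ | linProfile f0 f1 y = 0} :=
    isClosed_eq (continuous_linProfile h0 h1) continuous_const
  have hsub : {y : ℝ | 1 < |y|} ⊆ {y : ℝ | linProfile f0 f1 y = 0} := fun y hy => by
    have hev : (fun y => y * radRep f0 y) =ᶠ[nhds y] fun _ => 0 := by
      filter_upwards [(isOpen_lt continuous_const continuous_abs).mem_nhds hy] with z hz
      rw [radRep_eq_zero z0 (le_of_lt hz), mul_zero]
    change linProfile f0 f1 y = 0
    rw [linProfile, hev.deriv_eq, radRep_eq_zero z1 (le_of_lt hy)]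
    simp
  have hy0 : y ≠ 0 := fun h => by norm_num [h] at hy
  have hlim : Filter.Tendsto (fun n : ℕ => y * (1 + 1 / ((n : ℝ) + 1))) Filter.atTop (nhds y) := by
    simpa using (tendsto_one_div_add_atTop_nhds_zero_nat (𝕜 := ℝ)).const_add 1 |>.const_mul y
  refine hcl.mem_of_tendsto hlim (Filter.Eventually.of_forall fun n => hsub ?_)
  have : 0 < 1 / ((n : ℝ) + 1) := by positivity
  change 1 < |y * (1 + 1 / ((n : ℝ) + 1))|
  rw [abs_mul, abs_of_pos (by linarith : 0 < 1 + 1 / ((n : ℝ) + 1))]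
  nlinarith

theorem hasCompactSupport_of_ball {F : Type*} [Zero F] {f : E3 → F}
    (hf : ∀ x, 1 ≤ ‖x‖ → f x = 0) : HasCompactSupport f := by
  refine HasCompactSupport.intro (isCompact_closedBall (0 : E3) 1) fun x hx => hf x ?_
  rw [mem_closedBall_zero_iff, not_le] at hx
  exact hx.le

theorem integral_sq_fderiv_le_of_H1norm_le {f : E3 → ℝ} {k : ℝ} (hk : 0 ≤ k)
    (h : H1norm f ≤ k) : ∫ x, ‖fderiv ℝ f x‖ ^ 2 ≤ k ^ 2 := by
  rw [H1norm, ← Real.sqrt_eq_rpow, Real.sqrt_le_left hk] at h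
  linarith [(integral_nonneg fun x => sq_nonneg (f x) : 0 ≤ ∫ x, f x ^ 2)]

theorem integral_sq_fderiv_fderiv_le_of_H2norm_le {f : E3 → ℝ} {k : ℝ} (hk : 0 ≤ k)
    (h : H2norm f ≤ k) : ∫ x, ‖fderiv ℝ (fderiv ℝ f) x‖ ^ 2 ≤ k ^ 2 := by
  rw [H2norm, ← Real.sqrt_eq_rpow, Real.sqrt_le_left hk] at h
  linarith [(integral_nonneg fun x => sq_nonneg (f x) : 0 ≤ ∫ x, f x ^ 2),
    (integral_nonneg fun x => sq_nonneg ‖fderiv ℝ f x‖ : 0 ≤ ∫ x, ‖fderiv ℝ f x‖ ^ 2)]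

theorem abs_radRep_le_of_H1norm_le {f : E3 → ℝ} {k : ℝ} (hk : 0 < k) (hf : ContDiff ℝ 1 f)
    (hr : Radial f) (z : ∀ x, 1 ≤ ‖x‖ → f x = 0) (h : H1norm f ≤ k) {y : ℝ} (hy : 0 < y) :
    |radRep f y| ≤ k / √sphereArea / √y := by
  refine abs_le_of_integral_sq_deriv_le (div_pos hk (Real.sqrt_pos.2 sphereArea_pos))
    (contDiff_radRep hf) (fun y hy => radRep_eq_zero z hy) ?_ hy
  exact integral_sq_mul_le (hf.continuous_fderiv one_ne_zero).norm
    ((hasCompactSupport_of_ball z).fderiv ℝ).norm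
    (hr.abs_deriv_radRep_le (hf.differentiable one_ne_zero))
    (integral_sq_fderiv_le_of_H1norm_le hk.le h)

theorem deriv_radRep_eq_zero {f : E3 → ℝ} (hf : ContDiff ℝ 1 f) (z : ∀ x, 1 ≤ ‖x‖ → f x = 0)
    {y : ℝ} (hy : 1 ≤ |y|) : deriv (radRep f) y = 0 := by
  have h := linProfile_eq_zero (f1 := fun _ => 0) hf continuous_const z (fun _ _ => rfl) hy
  rw [linProfile_eq hf, radRep_eq_zero z hy] at h
  have hy0 : y ≠ 0 := fun h => by norm_num [h] at hy
  simpa [radRep, hy0] using h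

theorem hasCompactSupport_norm_fderiv_fderiv {f : E3 → ℝ} (z : ∀ x, 1 ≤ ‖x‖ → f x = 0) :
    HasCompactSupport fun x => ‖fderiv ℝ (fderiv ℝ f) x‖ := by
  have h : HasCompactSupport f := hasCompactSupport_of_ball z
  refine HasCompactSupport.intro h.isCompact fun x hx => ?_
  have h1 : fderiv ℝ f =ᶠ[nhds x] fun _ => 0 :=
    (notMem_tsupport_iff_eventuallyEq.1 fun hx' => hx (tsupport_fderiv_subset ℝ hx'))
  rw [h1.fderiv_eq, fderiv_fun_const, Pi.zero_apply]
  exact ContinuousLinearMap.opNorm_zero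

theorem abs_deriv_radRep_le_of_H2norm_le {f : E3 → ℝ} {k : ℝ} (hk : 0 < k) (hf : ContDiff ℝ 2 f)
    (hr : Radial f) (z : ∀ x, 1 ≤ ‖x‖ → f x = 0) (h : H2norm f ≤ k) {y : ℝ} (hy : 0 < y) :
    |deriv (radRep f) y| ≤ k / √sphereArea / √y := by
  have hf' : ContDiff ℝ 1 (fderiv ℝ f) := hf.fderiv_right (by norm_num)
  have hd : ContDiff ℝ 1 (deriv (radRep f)) :=
    ContDiff.deriv' (n := 1) (by simpa [one_add_one_eq_two] using contDiff_radRep hf)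
  exact abs_le_of_integral_sq_deriv_le (div_pos hk (Real.sqrt_pos.2 sphereArea_pos)) hd
    (fun y hy => deriv_radRep_eq_zero (hf.of_le (by norm_num)) z hy)
    (integral_sq_mul_le (hf'.continuous_fderiv one_ne_zero).norm (hasCompactSupport_norm_fderiv_fderiv z)
      (hr.abs_deriv_deriv_radRep_le hf)
      (integral_sq_fderiv_fderiv_le_of_H2norm_le hk.le h)) hy

theorem abs_linProfile_le {k : ℝ} (hk : 0 < k) (h0 : ContDiff ℝ 2 f0) (h1 : ContDiff ℝ 1 f1)
    (r0 : Radial f0) (r1 : Radial f1) (z0 : ∀ x, 1 ≤ ‖x‖ → f0 x = 0)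
    (z1 : ∀ x, 1 ≤ ‖x‖ → f1 x = 0) (hH : H2norm f0 + H1norm f1 ≤ k) (y : ℝ) :
    |linProfile f0 f1 y| ≤ 4 * (k / √sphereArea) := by
  have h0' : ContDiff ℝ 1 f0 := h0.of_le (by norm_num)
  have n0 : 0 ≤ H2norm f0 := by rw [H2norm, ← Real.sqrt_eq_rpow]; exact Real.sqrt_nonneg _
  have n1 : 0 ≤ H1norm f1 := by rw [H1norm, ← Real.sqrt_eq_rpow]; exact Real.sqrt_nonneg _
  set κ := k / √sphereArea with hκ
  have hκ0 : 0 < κ := div_pos hk (Real.sqrt_pos.2 sphereArea_pos)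
  have hsqrt : ∀ {y a : ℝ}, 0 < y → y ≤ 1 → |a| ≤ κ / √y → |y * a| ≤ κ := fun {y a} hy hy1 ha => by
    rw [abs_mul, abs_of_pos hy]
    calc y * |a| ≤ y * (κ / √y) := mul_le_mul_of_nonneg_left ha hy.le
      _ = √y * κ := by
        nth_rewrite 1 [← Real.mul_self_sqrt hy.le]
        have := (Real.sqrt_pos.2 hy).ne'
        field_simp
      _ ≤ 1 * κ := mul_le_mul_of_nonneg_right (Real.sqrt_le_one.2 hy1) hκ0.le
      _ = κ := one_mul κ
  have hpos : ∀ y, 0 < y → |radRep f0 y| + |y * deriv (radRep f0) y| + |y * radRep f1 y|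
      ≤ 4 * κ := fun y hy => by
    rcases le_or_gt y 1 with hy1 | hy1
    · have b0 : |radRep f0 y| ≤ 2 * κ := abs_le_of_abs_deriv_le_div_sqrt hκ0.le
        (contDiff_radRep h0') (fun y hy => radRep_eq_zero z0 hy)
        (fun y hy => abs_deriv_radRep_le_of_H2norm_le hk h0 r0 z0 (by linarith) hy) hy
      have b1 := hsqrt hy hy1
        (abs_deriv_radRep_le_of_H2norm_le hk h0 r0 z0 (by linarith) hy)
      have b2 := hsqrt hy hy1 (abs_radRep_le_of_H1norm_le hk h1 r1 z1 (by linarith) hy)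
      linarith
    · have hy' : 1 ≤ |y| := hy1.le.trans (le_abs_self y)
      rw [radRep_eq_zero z0 hy', radRep_eq_zero z1 hy', deriv_radRep_eq_zero h0' z0 hy']
      simp [hκ0.le]
  have hev : ∀ y, deriv (radRep f0) (-y) = - deriv (radRep f0) y := fun y => by
    have h := deriv_comp_neg (radRep f0) (-y)
    rw [funext r0.radRep_neg, neg_neg] at h
    exact h
  have hne : ∀ y, y ≠ 0 → |linProfile f0 f1 y| ≤ 4 * κ := fun y hy => by
    rw [linProfile_eq h0']
    refine (abs_add_three _ _ _).trans ?_
    rcases hy.lt_or_gt with hy | hy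
    · have h := hpos (-y) (neg_pos.2 hy)
      rw [hev, r0.radRep_neg, r1.radRep_neg] at h
      simpa [abs_mul] using h
    · exact hpos y hy
  have hcl : IsClosed {y | |linProfile f0 f1 y| ≤ 4 * κ} :=
    isClosed_le (continuous_linProfile h0' h1.continuous).abs continuous_const
  exact hcl.closure_subset_iff.2 (fun y hy => hne y hy) ((dense_compl_singleton (0 : ℝ)) y)

theorem continuous_linMean (h0 : ContDiff ℝ 1 f0) (h1 : Continuous f1) :
    Continuous (fun p : ℝ × ℝ => linMean f0 f1 p.1 p.2) := by
  refine continuous_const.mul ?_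
  refine intervalIntegral.continuous_parametric_intervalIntegral_of_continuous'
    (f := fun (p : ℝ × ℝ) s => linProfile f0 f1 (p.1 + p.2 * s)) ?_ _ _
  exact (continuous_linProfile h0 h1).comp
    (by fun_prop : Continuous fun z : (ℝ × ℝ) × ℝ => z.1.1 + z.1.2 * z.2)

theorem mul_linMean_eq_integral (t r : ℝ) :
    r * linMean f0 f1 t r = (1 / 2) * ∫ y in (t - r)..(t + r), linProfile f0 f1 y := by
  have h := intervalIntegral.mul_integral_comp_add_mul (a := -1) (b := 1)
    (f := linProfile f0 f1) r t
  rw [show t + r * -1 = t - r by ring, mul_one] at h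
  rw [linMean, ← h]
  ring

theorem mul_linMean (h0 : ContDiff ℝ 1 f0) (h1 : Continuous f1) (r0 : Radial f0)
    (r1 : Radial f1) (t r : ℝ) : r * linMean f0 f1 t r = psiLin f0 f1 t r := by
  have e0 : Continuous (radRep f0) := (contDiff_radRep h0).continuous
  have e1 : Continuous (deriv (radRep f0)) := (contDiff_radRep h0).continuous_deriv le_rfl
  have e2 : Continuous (radRep f1) := (contDiff_radRep (contDiff_zero.2 h1)).continuous
  have hodd : ∀ a b : ℝ, ∫ y in (-a)..b, y * radRep f1 y = ∫ y in a..b, y * radRep f1 y :=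
      fun a b => by
    have hc : Continuous fun y => y * radRep f1 y := by fun_prop
    have ho : ∀ y, -y * radRep f1 (-y) = -(y * radRep f1 y) := fun y => by
      rw [r1.radRep_neg]; ring
    rw [← integral_abs_left_of_odd hc ho (-a), ← integral_abs_left_of_odd hc ho a, abs_neg]
  rw [mul_linMean_eq_integral, funext (linProfile_eq (f1 := f1) h0),
    intervalIntegral.integral_add (Continuous.intervalIntegrable (by fun_prop) _ _)
      (Continuous.intervalIntegrable (by fun_prop) _ _),
    intervalIntegral.integral_eq_sub_of_hasDerivAt
      (f := fun y => y * radRep f0 y) (fun y _ => hasDerivAt_mul_radRep h0 y)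
      (Continuous.intervalIntegrable (by fun_prop) _ _), psiLin,
    ← hodd (t - r), neg_sub, add_comm t r, ← neg_sub r t, r0.radRep_neg]
  ring

theorem linMean_eq_zero_of_le (h0 : ContDiff ℝ 1 f0) (h1 : Continuous f1) (r0 : Radial f0)
    (r1 : Radial f1) (z0 : ∀ x, 1 ≤ ‖x‖ → f0 x = 0) (z1 : ∀ x, 1 ≤ ‖x‖ → f1 x = 0) {t r : ℝ}
    (ht : 0 ≤ t) (htr : t + 1 ≤ r) : linMean f0 f1 t r = 0 := by
  have h := mul_linMean h0 h1 r0 r1 t r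
  have hi : ∫ y in (r - t)..(r + t), y * radRep f1 y = 0 := by
    rw [intervalIntegral.integral_congr (g := fun _ => 0)]
    · simp
    · intro y hy
      rw [uIcc_of_le (by linarith)] at hy
      simp only
      rw [radRep_eq_zero z1 (le_abs.2 (Or.inl (by linarith [hy.1]))), mul_zero]
  rw [psiLin, hi, radRep_eq_zero z0 (le_abs.2 (Or.inl (by linarith))),
    radRep_eq_zero z0 (le_abs.2 (Or.inl (by linarith)))] at h
  simp only [mul_zero, add_zero, zero_div, mul_eq_zero] at h
  exact h.resolve_left (by linarith)

theorem linMean_eq_zero_of_ge (h0 : ContDiff ℝ 1 f0) (h1 : Continuous f1)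
    (z0 : ∀ x, 1 ≤ ‖x‖ → f0 x = 0) (z1 : ∀ x, 1 ≤ ‖x‖ → f1 x = 0) {t r : ℝ}
    (hr : 0 ≤ r) (htr : 1 ≤ t - r) : linMean f0 f1 t r = 0 := by
  rw [linMean, intervalIntegral.integral_congr (g := fun _ => 0)]
  · simp
  · intro s hs
    rw [uIcc_of_le (by norm_num)] at hs
    refine linProfile_eq_zero h0 h1 z0 z1 (le_abs.2 (Or.inl ?_))
    nlinarith [hs.1]

theorem abs_linMean_le {N : ℝ} (h0 : ContDiff ℝ 1 f0) (h1 : Continuous f1) (r0 : Radial f0)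
    (r1 : Radial f1) (z0 : ∀ x, 1 ≤ ‖x‖ → f0 x = 0) (z1 : ∀ x, 1 ≤ ‖x‖ → f1 x = 0)
    (hN : ∀ y, |linProfile f0 f1 y| ≤ N) (s : ℝ) {t r : ℝ} (ht : 0 ≤ t) (hr : 0 ≤ r) :
    |linMean f0 f1 t r| ≤ 5 * 3 ^ |s| * N * weight s t r := by
  have hN0 : 0 ≤ N := (abs_nonneg _).trans (hN 0)
  have hw := (weight_pos s t r).le
  rcases le_or_gt (t + 1) r with h | h
  · rw [linMean_eq_zero_of_le h0 h1 r0 r1 z0 z1 ht h, abs_zero]; positivity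
  rcases le_or_gt 1 (t - r) with h' | h'
  · rw [linMean_eq_zero_of_ge h0 h1 z0 z1 hr h', abs_zero]; positivity
  have hV : 0 < 2 + t + r := by linarith
  have b1 : |linMean f0 f1 t r| ≤ N := by
    have := intervalIntegral.norm_integral_le_of_norm_le_const (a := -1) (b := 1)
      (f := fun s => linProfile f0 f1 (t + r * s)) (C := N) (fun s _ => hN _)
    rw [Real.norm_eq_abs] at this
    rw [linMean, abs_mul, abs_of_pos (by norm_num : (0 : ℝ) < 1 / 2)]
    norm_num at this
    linarith
  have b2 : r * |linMean f0 f1 t r| ≤ N := by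
    have hi : ∫ y in Ioc (t - r) (t + r), |linProfile f0 f1 y| ≤ 2 * N := by
      have hle : ∀ y, |linProfile f0 f1 y| ≤ (Icc (-1 : ℝ) 1).indicator (fun _ => N) y := fun y => by
        by_cases hy : y ∈ Icc (-1 : ℝ) 1
        · rw [indicator_of_mem hy]; exact hN y
        · rw [indicator_of_notMem hy, linProfile_eq_zero h0 h1 z0 z1, abs_zero]
          by_contra hlt
          exact hy (abs_le.1 (not_le.1 hlt).le)
      have hint : Integrable ((Icc (-1 : ℝ) 1).indicator (fun _ : ℝ => N)) :=
        (integrable_indicator_iff measurableSet_Icc).2 (by simp)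
      calc ∫ y in Ioc (t - r) (t + r), |linProfile f0 f1 y|
          ≤ ∫ y in Ioc (t - r) (t + r), (Icc (-1 : ℝ) 1).indicator (fun _ => N) y :=
            integral_mono_of_nonneg (Filter.Eventually.of_forall fun y => abs_nonneg _)
              hint.integrableOn (Filter.Eventually.of_forall hle)
        _ ≤ ∫ y, (Icc (-1 : ℝ) 1).indicator (fun _ => N) y :=
            setIntegral_le_integral hint (Filter.Eventually.of_forall fun y =>
              (abs_nonneg _).trans (hle y))
        _ = 2 * N := by
            rw [integral_indicator measurableSet_Icc]
            simp; norm_num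
    have h2 := congrArg abs (mul_linMean_eq_integral (f0 := f0) (f1 := f1) t r)
    rw [abs_mul, abs_mul, abs_of_nonneg hr, abs_of_pos (by norm_num : (0 : ℝ) < 1 / 2)] at h2
    have h3 := intervalIntegral.abs_integral_le_integral_abs (μ := volume)
      (f := linProfile f0 f1) (by linarith : t - r ≤ t + r)
    rw [intervalIntegral.integral_of_le (by linarith)] at h3
    rw [intervalIntegral.integral_of_le (by linarith)] at h3
    rw [intervalIntegral.integral_of_le (by linarith)] at h2
    linarith
  have b3 : |linMean f0 f1 t r| ≤ 5 * N * (2 + t + r)⁻¹ := by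
    rw [← div_eq_mul_inv, le_div_iff₀ hV]
    nlinarith [abs_nonneg (linMean f0 f1 t r)]
  have b4 : 1 ≤ 3 ^ |s| * (2 + t - r) ^ (-s) := by
    have hU1 : 1 ≤ 2 + t - r := by linarith
    have e1 : (2 + t - r) ^ (-|s|) ≤ (2 + t - r) ^ (-s) :=
      Real.rpow_le_rpow_of_exponent_le hU1 (neg_le_neg (le_abs_self s))
    have e2 : (3 : ℝ) ^ (-|s|) ≤ (2 + t - r) ^ (-|s|) :=
      Real.rpow_le_rpow_of_nonpos (by linarith) (by linarith) (by simp)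
    have e3 : (3 : ℝ) ^ |s| * 3 ^ (-|s|) = 1 := by
      rw [← Real.rpow_add three_pos]; simp
    rw [← e3]
    gcongr
    exact e2.trans e1
  rw [weight_of_le ht hr h.le]
  calc |linMean f0 f1 t r| ≤ 5 * N * (2 + t + r)⁻¹ := b3
    _ ≤ 5 * N * (2 + t + r)⁻¹ * (3 ^ |s| * (2 + t - r) ^ (-s)) :=
        le_mul_of_one_le_right (by positivity) b4
    _ = _ := by ring

end Linear

section FixedPoint

open BoundedContinuousFunction

/-- The kernel `y * |φ|^c` for `φ = weight σ * f`, extended oddly to `y < 0`. -/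
def powerKernel (c σ : ℝ) (f : (ℝ × ℝ) →ᵇ ℝ) (t y : ℝ) : ℝ :=
  y * |weight σ t y * f (t, |y|)| ^ c

theorem continuous_powerKernel {c : ℝ} (hc : 0 ≤ c) (σ : ℝ) (f : (ℝ × ℝ) →ᵇ ℝ) :
    Continuous (Function.uncurry (powerKernel c σ f)) := by
  have hw := continuous_weight σ
  have hf : Continuous fun p : ℝ × ℝ => f (p.1, |p.2|) := f.continuous.comp (by fun_prop)
  exact continuous_snd.mul ((hw.mul hf).abs.rpow_const fun _ => Or.inr hc)

theorem powerKernel_neg (c σ : ℝ) (f : (ℝ × ℝ) →ᵇ ℝ) (t y : ℝ) :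
    powerKernel c σ f t (-y) = -powerKernel c σ f t y := by
  simp [powerKernel, weight]

theorem powerKernel_eq_zero {c : ℝ} (hc : c ≠ 0) (σ : ℝ) {f : (ℝ × ℝ) →ᵇ ℝ}
    (hf : ∀ t r, 0 ≤ t → t + 1 ≤ r → f (t, r) = 0) {t y : ℝ} (ht : 0 ≤ t) (hy : t + 1 ≤ y) :
    powerKernel c σ f t y = 0 := by
  rw [powerKernel, hf t |y| ht (hy.trans (le_abs_self y)), mul_zero, abs_zero,
    Real.zero_rpow hc, mul_zero]

theorem abs_powerKernel_sub_le {c σ ρ : ℝ} (hc : 1 ≤ c) {f g : (ℝ × ℝ) →ᵇ ℝ} (hf : ‖f‖ ≤ ρ)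
    (hg : ‖g‖ ≤ ρ) (t : ℝ) {y : ℝ} (hy : 0 ≤ y) :
    |powerKernel c σ f t y - powerKernel c σ g t y|
      ≤ c * ρ ^ (c - 1) * dist f g * (y * weight σ t y ^ c) := by
  have hw := weight_pos σ t y
  have hρ : 0 ≤ ρ := (norm_nonneg f).trans hf
  have hle : ∀ {h : (ℝ × ℝ) →ᵇ ℝ}, ‖h‖ ≤ ρ →
      |weight σ t y * h (t, |y|)| ≤ weight σ t y * ρ := fun {h} hh => by
    rw [abs_mul, abs_of_pos hw]
    exact mul_le_mul_of_nonneg_left ((h.norm_coe_le_norm _).trans hh) hw.le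
  have h := abs_abs_rpow_sub_abs_rpow_le hc (hle hf) (hle hg)
  have hd : |weight σ t y * f (t, |y|) - weight σ t y * g (t, |y|)|
      ≤ weight σ t y * dist f g := by
    rw [← mul_sub, abs_mul, abs_of_pos hw, ← Real.dist_eq]
    exact mul_le_mul_of_nonneg_left (dist_coe_le_dist _) hw.le
  rw [powerKernel, powerKernel, ← mul_sub, abs_mul y, abs_of_nonneg hy]
  rw [abs_of_nonneg hy] at h hd
  calc y * |(|weight σ t y * f (t, y)| ^ c - |weight σ t y * g (t, y)| ^ c)|
      ≤ y * (c * (weight σ t y * ρ) ^ (c - 1) * (weight σ t y * dist f g)) := by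
        refine mul_le_mul_of_nonneg_left (h.trans ?_) hy
        exact mul_le_mul_of_nonneg_left hd (by positivity)
    _ = c * ρ ^ (c - 1) * dist f g * (y * (weight σ t y ^ (c - 1) * weight σ t y)) := by
        rw [Real.mul_rpow hw.le hρ]; ring
    _ = _ := by rw [← Real.rpow_add_one hw.ne', sub_add_cancel]

theorem abs_duhamelMean_powerKernel_sub_le {c s σ ρ : ℝ} (hc : 2 < c) (h₁ : s < c - 2)
    (h₂ : s < c - 3 + c * σ) (hρ1 : ρ ≤ 1) {f g : (ℝ × ℝ) →ᵇ ℝ} (hf : ‖f‖ ≤ ρ) (hg : ‖g‖ ≤ ρ)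
    (zf : ∀ t r, 0 ≤ t → t + 1 ≤ r → f (t, r) = 0) (zg : ∀ t r, 0 ≤ t → t + 1 ≤ r → g (t, r) = 0)
    {t r : ℝ} (ht : 0 ≤ t) (hr : 0 ≤ r) :
    |duhamelMean (powerKernel c σ f) t r - duhamelMean (powerKernel c σ g) t r|
      ≤ c * ((1 + 1 / (c - 2)) / (c - 2 - s)) * ρ * dist f g * weight s t r := by
  have hρ : 0 ≤ ρ := (norm_nonneg f).trans hf
  have hcf := continuous_powerKernel (by linarith : 0 ≤ c) σ f
  have hcg := continuous_powerKernel (by linarith : 0 ≤ c) σ g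
  have hpow : ρ ^ (c - 1) ≤ ρ := by
    simpa using Real.rpow_le_rpow_of_exponent_ge' hρ hρ1 zero_le_one (by linarith : 1 ≤ c - 1)
  have hC : 0 ≤ (1 + 1 / (c - 2)) / (c - 2 - s) :=
    div_nonneg (add_nonneg zero_le_one (one_div_nonneg.2 (by linarith))) (by linarith)
  rw [← duhamelMean_sub hcf hcg]
  refine (abs_duhamelMean_le (B := c * ρ * dist f g) hc h₁ h₂
    (by exact hcf.sub hcg) (fun t y => ?_)
    (fun t y ht hy => ?_) (by positivity) (fun t y ht hy => ?_) ht hr).trans_eq (by ring)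
  · rw [powerKernel_neg, powerKernel_neg]; ring
  · rw [powerKernel_eq_zero (by linarith) σ zf ht hy, powerKernel_eq_zero (by linarith) σ zg ht hy,
      sub_zero]
  · refine (abs_powerKernel_sub_le (by linarith) hf hg t hy).trans ?_
    have := weight_pos σ t y
    gcongr

variable {d : ℕ}

/-- The closed ball of radius `ρ`, intersected with the functions supported in `r ≤ t + 1`. -/
def causalBall (d : ℕ) (ρ : ℝ) : Set (Fin d → (ℝ × ℝ) →ᵇ ℝ) :=
  {f | ∀ j, ‖f j‖ ≤ ρ ∧ ∀ t r, 0 ≤ t → t + 1 ≤ r → f j (t, r) = 0}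

theorem isClosed_causalBall (ρ : ℝ) : IsClosed (causalBall d ρ) := by
  have h : causalBall d ρ = ⋂ j, ({f | ‖f j‖ ≤ ρ} ∩
      ⋂ t, ⋂ r, ⋂ (_ : 0 ≤ t), ⋂ (_ : t + 1 ≤ r), {f | f j (t, r) = 0}) := by
    ext f
    simp [causalBall]
  rw [h]
  refine isClosed_iInter fun j => IsClosed.inter
    (isClosed_le (continuous_apply j).norm continuous_const) ?_
  refine isClosed_iInter fun t => isClosed_iInter fun r => isClosed_iInter fun _ =>
    isClosed_iInter fun _ => isClosed_eq ?_ continuous_const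
  exact (continuous_eval_const (t, r)).comp (continuous_apply j)

/-- The right-hand side of the Duhamel formula with linear part `L`. -/
def picard (a c : Fin d → Fin d → ℝ) (s : Fin d → ℝ) (L : Fin d → ℝ → ℝ → ℝ)
    (f : Fin d → (ℝ × ℝ) →ᵇ ℝ) (i : Fin d) (t r : ℝ) : ℝ :=
  L i t r + ∑ j, a i j * duhamelMean (powerKernel (c i j) (s j) (f j)) t r

theorem abs_picard_sub_le {a c : Fin d → Fin d → ℝ} {s : Fin d → ℝ} (hc : ∀ i j, 2 < c i j)
    (hs : ∀ i j, a i j ≠ 0 → s i < c i j - 2 ∧ s i < c i j - 3 + c i j * s j) {ρ : ℝ}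
    (hρ1 : ρ ≤ 1) (L : Fin d → ℝ → ℝ → ℝ) {f g : Fin d → (ℝ × ℝ) →ᵇ ℝ}
    (hf : f ∈ causalBall d ρ) (hg : g ∈ causalBall d ρ) (i : Fin d) {t r : ℝ} (ht : 0 ≤ t)
    (hr : 0 ≤ r) :
    |picard a c s L f i t r - picard a c s L g i t r|
      ≤ (∑ j, |a i j| * (c i j * ((1 + 1 / (c i j - 2)) / (c i j - 2 - s i)))) * ρ * dist f g
        * weight (s i) t r := by
  rw [picard, picard, add_sub_add_left_eq_sub, ← Finset.sum_sub_distrib, Finset.sum_mul,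
    Finset.sum_mul, Finset.sum_mul]
  refine (Finset.abs_sum_le_sum_abs _ _).trans (Finset.sum_le_sum fun j _ => ?_)
  rw [← mul_sub, abs_mul]
  rcases eq_or_ne (a i j) 0 with h0 | h0
  · simp [h0]
  obtain ⟨h₁, h₂⟩ := hs i j h0
  have hρ : 0 ≤ ρ := (norm_nonneg (f j)).trans (hf j).1
  have hw := weight_pos (s i) t r
  have hcij := hc i j
  have hC : 0 ≤ (1 + 1 / (c i j - 2)) / (c i j - 2 - s i) :=
    div_nonneg (add_nonneg zero_le_one (one_div_nonneg.2 (by linarith))) (by linarith)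
  have hd : dist (f j) (g j) ≤ dist f g := dist_le_pi_dist f g j
  have hc0 : 0 ≤ c i j := by linarith
  calc |a i j| * |duhamelMean (powerKernel (c i j) (s j) (f j)) t r
        - duhamelMean (powerKernel (c i j) (s j) (g j)) t r|
      ≤ |a i j| * (c i j * ((1 + 1 / (c i j - 2)) / (c i j - 2 - s i)) * ρ * dist f g
        * weight (s i) t r) := by
        refine mul_le_mul_of_nonneg_left ?_ (abs_nonneg _)
        refine (abs_duhamelMean_powerKernel_sub_le hcij h₁ h₂ hρ1 (hf j).1 (hg j).1 (hf j).2
          (hg j).2 ht hr).trans ?_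
        gcongr
    _ = _ := by ring

theorem continuous_picard {a c : Fin d → Fin d → ℝ} (s : Fin d → ℝ) (hc : ∀ i j, 2 < c i j)
    {L : Fin d → ℝ → ℝ → ℝ} (hL : ∀ i, Continuous fun p : ℝ × ℝ => L i p.1 p.2)
    (f : Fin d → (ℝ × ℝ) →ᵇ ℝ) (i : Fin d) :
    Continuous fun p : ℝ × ℝ => picard a c s L f i p.1 p.2 :=
  (hL i).add (continuous_finsetSum _ fun j _ => continuous_const.mul
    (continuous_duhamelMean (continuous_powerKernel (by linarith [hc i j]) (s j) (f j))))

theorem picard_eq_zero {a c : Fin d → Fin d → ℝ} (s : Fin d → ℝ) (hc : ∀ i j, 2 < c i j) {ρ : ℝ}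
    {L : Fin d → ℝ → ℝ → ℝ} (zL : ∀ i t r, 0 ≤ t → t + 1 ≤ r → L i t r = 0)
    {f : Fin d → (ℝ × ℝ) →ᵇ ℝ} (hf : f ∈ causalBall d ρ) (i : Fin d) {t r : ℝ} (ht : 0 ≤ t)
    (htr : t + 1 ≤ r) : picard a c s L f i t r = 0 := by
  rw [picard, zL i t r ht htr, zero_add]
  refine Finset.sum_eq_zero fun j _ => ?_
  have hcij := hc i j
  rw [duhamelMean_eq_zero (continuous_powerKernel (by linarith) _ _) (powerKernel_neg _ _ _)
    (fun t y ht hy => powerKernel_eq_zero (by linarith) _ (hf j).2 ht hy) ht htr, mul_zero]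

theorem picard_zero {a c : Fin d → Fin d → ℝ} (s : Fin d → ℝ) (hc : ∀ i j, 2 < c i j)
    (L : Fin d → ℝ → ℝ → ℝ) (i : Fin d) (t r : ℝ) : picard a c s L 0 i t r = L i t r := by
  have h : ∀ j, powerKernel (c i j) (s j) 0 = fun _ _ => 0 := fun j => by
    funext t y
    have hcij := hc i j
    simp [powerKernel, Real.zero_rpow (by linarith : c i j ≠ 0)]
  simp [picard, h, duhamelMean]

theorem exists_picard_fixedPoint {a c : Fin d → Fin d → ℝ} {s : Fin d → ℝ}
    (hc : ∀ i j, 2 < c i j)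
    (hs : ∀ i j, a i j ≠ 0 → s i < c i j - 2 ∧ s i < c i j - 3 + c i j * s j) :
    ∃ ρ : ℝ, 0 < ρ ∧ ∀ L : Fin d → ℝ → ℝ → ℝ, (∀ i, Continuous fun p : ℝ × ℝ => L i p.1 p.2) →
      (∀ i t r, 0 ≤ t → t + 1 ≤ r → L i t r = 0) →
      (∀ i t r, 0 ≤ t → 0 ≤ r → |L i t r| ≤ ρ / 2 * weight (s i) t r) →
      ∃ f ∈ causalBall d ρ, ∀ i t r, 0 ≤ t → 0 ≤ r →
        weight (s i) t r * f i (t, r) = picard a c s L f i t r := by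
  set A : Fin d → ℝ := fun i =>
    ∑ j, |a i j| * (c i j * ((1 + 1 / (c i j - 2)) / (c i j - 2 - s i))) with hA
  have hA0 : ∀ i, 0 ≤ A i := fun i => Finset.sum_nonneg fun j _ => by
    rcases eq_or_ne (a i j) 0 with h0 | h0
    · simp [h0]
    have hcij := hc i j
    have := (hs i j h0).1
    exact mul_nonneg (abs_nonneg _) (mul_nonneg (by linarith)
      (div_nonneg (add_nonneg zero_le_one (one_div_nonneg.2 (by linarith))) (by linarith)))
  have hS0 : 0 ≤ ∑ i, A i := Finset.sum_nonneg fun i _ => hA0 i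
  set ρ : ℝ := (2 * (1 + ∑ i, A i))⁻¹ with hρdef
  have hρ : 0 < ρ := inv_pos.2 (by linarith)
  have hρ1 : ρ ≤ 1 := inv_le_one_of_one_le₀ (by linarith)
  have hAρ : ∀ i, A i * ρ ≤ 1 / 2 := fun i => by
    have : A i ≤ ∑ i, A i := Finset.single_le_sum (fun i _ => hA0 i) (Finset.mem_univ i)
    rw [hρdef, ← div_eq_mul_inv, div_le_div_iff₀ (by linarith) two_pos]
    linarith
  refine ⟨ρ, hρ, fun L hL zL bL => ?_⟩
  have h0mem : (0 : Fin d → (ℝ × ℝ) →ᵇ ℝ) ∈ causalBall d ρ := fun j => by simp [hρ.le]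
  have hdiff : ∀ f ∈ causalBall d ρ, ∀ g ∈ causalBall d ρ, ∀ i t r, 0 ≤ t → 0 ≤ r →
      |picard a c s L f i t r - picard a c s L g i t r|
        ≤ 1 / 2 * dist f g * weight (s i) t r := fun f hf g hg i t r ht hr => by
    refine (abs_picard_sub_le hc hs hρ1 L hf hg i ht hr).trans ?_
    have := weight_pos (s i) t r
    have := hAρ i
    gcongr
  have hbd : ∀ f ∈ causalBall d ρ, ∀ i t r, 0 ≤ t → 0 ≤ r →
      |picard a c s L f i t r| ≤ ρ * weight (s i) t r := fun f hf i t r ht hr => by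
    have h1 := hdiff f hf 0 h0mem i t r ht hr
    rw [picard_zero s hc] at h1
    have h2 := bL i t r ht hr
    have h3 : dist f 0 ≤ ρ := by
      rw [dist_zero_right]
      exact (pi_norm_le_iff_of_nonneg hρ.le).2 fun j => (hf j).1
    have h4 : 1 / 2 * dist f 0 * weight (s i) t r ≤ 1 / 2 * ρ * weight (s i) t r := by
      have := weight_pos (s i) t r
      gcongr
    have h5 := abs_sub_abs_le_abs_sub (picard a c s L f i t r) (L i t r)
    linarith
  have hex : ∀ f : causalBall d ρ, ∃ F : causalBall d ρ, ∀ i t r,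
      F.1 i (t, r) = picard a c s L f.1 i |t| |r| / weight (s i) |t| |r| := fun f => by
    have hb : ∀ i (p : ℝ × ℝ),
        ‖picard a c s L f.1 i |p.1| |p.2| / weight (s i) |p.1| |p.2|‖ ≤ ρ := fun i p => by
      have hw := weight_pos (s i) |p.1| |p.2|
      rw [Real.norm_eq_abs, abs_div, abs_of_pos hw, div_le_iff₀ hw]
      exact hbd f.1 f.2 i _ _ (abs_nonneg _) (abs_nonneg _)
    have habs : Continuous fun p : ℝ × ℝ => (|p.1|, |p.2|) := by fun_prop
    let F : Fin d → (ℝ × ℝ) →ᵇ ℝ := fun i => ofNormedAddCommGroup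
      (fun p : ℝ × ℝ => picard a c s L f.1 i |p.1| |p.2| / weight (s i) |p.1| |p.2|)
      (((continuous_picard s hc hL f.1 i).comp habs).div₀ ((continuous_weight (s i)).comp habs)
        fun p => (weight_pos _ _ _).ne') ρ (hb i)
    refine ⟨⟨F, fun j => ⟨norm_ofNormedAddCommGroup_le _ hρ.le (hb j), fun t r ht htr => ?_⟩⟩,
      fun i t r => rfl⟩
    change picard a c s L f.1 j |t| |r| / weight (s j) |t| |r| = 0
    rw [abs_of_nonneg ht, abs_of_nonneg (by linarith : 0 ≤ r),
      picard_eq_zero s hc zL f.2 j ht htr, zero_div]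
  choose T hT using hex
  have hcontr : ContractingWith (1 / 2) T := by
    refine ⟨by norm_num, LipschitzWith.of_dist_le_mul fun f g => ?_⟩
    have hnn : 0 ≤ 1 / 2 * dist f g := by positivity
    have : dist (T f).1 (T g).1 ≤ 1 / 2 * dist f g := by
      refine (dist_pi_le_iff hnn).2 fun i => (dist_le hnn).2 fun p => ?_
      have hw := weight_pos (s i) |p.1| |p.2|
      rw [hT f i p.1 p.2, hT g i p.1 p.2, Real.dist_eq, ← sub_div, abs_div, abs_of_pos hw,
        div_le_iff₀ hw]
      exact hdiff f.1 f.2 g.1 g.2 i _ _ (abs_nonneg _) (abs_nonneg _)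
    simpa [Subtype.dist_eq] using this
  have : CompleteSpace (causalBall d ρ) := (isClosed_causalBall ρ).completeSpace_coe
  have : Nonempty (causalBall d ρ) := ⟨⟨0, h0mem⟩⟩
  refine ⟨(hcontr.fixedPoint T).1, (hcontr.fixedPoint T).2, fun i t r ht hr => ?_⟩
  have h := hT (hcontr.fixedPoint T) i t r
  rw [hcontr.fixedPoint_isFixedPt.eq, abs_of_nonneg ht, abs_of_nonneg hr] at h
  rw [h, mul_div_cancel₀ _ (weight_pos _ _ _).ne']

end FixedPoint

theorem jap_rpow_mul_weight_le (s : ℝ) {t r : ℝ} (ht : 0 ≤ t) (hr : 0 ≤ r) (hrt : r ≤ t + 1) :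
    jap ((t + r) / 2) ^ (1 / 2 : ℝ) * jap ((t - r) / 2) ^ s * weight s t r ≤ 4 ^ |s| := by
  have hV : 0 < 2 + t + r := by linarith
  have hU : 0 < 2 + t - r := by linarith
  have j1 : 0 < jap ((t - r) / 2) := Real.sqrt_pos.2 (by positivity)
  have b1 : jap ((t + r) / 2) ^ (1 / 2 : ℝ) ≤ 2 + t + r := by
    have h1 : jap ((t + r) / 2) ≤ 2 + t + r := (Real.sqrt_le_left hV.le).2 (by nlinarith)
    refine (Real.rpow_le_rpow (Real.sqrt_nonneg _) h1 (by norm_num)).trans ?_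
    simpa using Real.rpow_le_rpow_of_exponent_le (by linarith : 1 ≤ 2 + t + r)
      (by norm_num : (1 / 2 : ℝ) ≤ 1)
  have b2 : jap ((t - r) / 2) ^ s ≤ 4 ^ |s| * (2 + t - r) ^ s := by
    rcases le_total 0 s with hs | hs
    · rw [abs_of_nonneg hs, ← Real.mul_rpow (by norm_num) hU.le]
      refine Real.rpow_le_rpow j1.le ((Real.sqrt_le_left (by linarith)).2 ?_) hs
      nlinarith
    · rw [abs_of_nonpos hs, Real.rpow_neg (by norm_num), ← Real.inv_rpow (by norm_num),
        ← Real.mul_rpow (by norm_num) hU.le]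
      refine Real.rpow_le_rpow_of_nonpos (by linarith) (Real.le_sqrt_of_sq_le ?_) hs
      nlinarith [sq_nonneg (t - r - 2)]
  rw [weight_of_le ht hr hrt, Real.rpow_neg hU.le]
  have hUs := Real.rpow_pos_of_pos hU s
  have j2 : 0 ≤ jap ((t - r) / 2) ^ s := Real.rpow_nonneg j1.le _
  calc jap ((t + r) / 2) ^ (1 / 2 : ℝ) * jap ((t - r) / 2) ^ s
        * ((2 + t + r)⁻¹ * ((2 + t - r) ^ s)⁻¹)
      ≤ (2 + t + r) * (4 ^ |s| * (2 + t - r) ^ s) * ((2 + t + r)⁻¹ * ((2 + t - r) ^ s)⁻¹) := by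
        gcongr
    _ = 4 ^ |s| := by field_simp

theorem radRep_comp_norm (g : ℝ → ℝ) (r : ℝ) : radRep (fun x => g ‖x‖) r = g |r| := by
  simp [radRep, norm_smul]

theorem mul_picard_eq {d : ℕ} {a c : Fin d → Fin d → ℝ} (s : Fin d → ℝ)
    (hc : ∀ i j, 2 < c i j) (L : Fin d → ℝ → ℝ → ℝ)
    (f : Fin d → BoundedContinuousFunction (ℝ × ℝ) ℝ) (i : Fin d) {t r : ℝ} (ht : 0 ≤ t)
    (hr : 0 ≤ r) :
    r * picard a c s L f i t r = r * L i t r + (1 / 2) * ∫ p in Dreg t r,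
      (p.2 * ∑ j, a i j * |weight (s j) p.1 p.2 * f j (p.1, |p.2|)| ^ (c i j)) := by
  have hK : ∀ j, Continuous (Function.uncurry (powerKernel (c i j) (s j) (f j))) := fun j =>
    continuous_powerKernel (by linarith [hc i j]) _ _
  have e : ∀ p : ℝ × ℝ, p.2 * ∑ j, a i j * |weight (s j) p.1 p.2 * f j (p.1, |p.2|)| ^ (c i j)
      = ∑ j, a i j * powerKernel (c i j) (s j) (f j) p.1 p.2 := fun p => by
    rw [Finset.mul_sum]
    exact Finset.sum_congr rfl fun j _ => by rw [powerKernel]; ring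
  simp only [e]
  have hint : ∀ j, IntegrableOn (fun p : ℝ × ℝ => a i j * powerKernel (c i j) (s j) (f j) p.1 p.2)
      (Dreg t r) := fun j =>
    ((hK j).continuousOn.integrableOn_compact (isCompact_Dreg t r)).const_mul (a i j)
  rw [integral_finsetSum _ fun j _ => hint j, picard, mul_add, Finset.mul_sum, Finset.mul_sum]
  congr 1
  refine Finset.sum_congr rfl fun j _ => ?_
  rw [integral_const_mul, mul_left_comm, mul_duhamelMean (hK j) (powerKernel_neg _ _ _) ht hr]
  ring

/-- Small-data global existence for the `n`-Strauss system `□φ_i = ∑_j a_{ij}|φ_j|^{c_{ij}}`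
in `ℝ^{3+1}` with `c_{ij} > 2`: if the fixed-point system
`s_i = min_{j : a_{ij} ≠ 0}(c̃_{ij} - 2 + min(0, c̃_{ij}s_j - 1))` is solvable for all
`ε̂`-perturbations `c̃` of the exponents, then for all small smooth radial data supported
in the unit ball there is a global solution in the Duhamel sense, with weighted decay
`⟨v⟩^{1-ε}⟨u⟩^{β_i}|φ_i|` bounded. -/
theorem stmt_19 (d : ℕ) (hd : 1 ≤ d) (a c : Fin d → Fin d → ℝ)
    (hc : ∀ i j, 2 < c i j) (hne : ∀ i, ∃ j, a i j ≠ 0)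
    (εhat : ℝ) (hεhat : 0 < εhat)
    (hpert : ∀ c' : Fin d → Fin d → ℝ, (∀ i j, |c' i j - c i j| ≤ εhat) →
      ∃ s : Fin d → ℝ, ∀ i,
        s i = ⨅ j : {j : Fin d // a i j ≠ 0}, (c' i j.1 - 2 + min 0 (c' i j.1 * s j.1 - 1))) :
    ∃ δ : ℝ, 0 < δ ∧
      ∀ φ0 φ1 : Fin d → E3 → ℝ,
        (∀ i, ContDiff ℝ (⊤ : ℕ∞) (φ0 i)) → (∀ i, ContDiff ℝ (⊤ : ℕ∞) (φ1 i)) →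
        (∀ i, Radial (φ0 i)) → (∀ i, Radial (φ1 i)) →
        (∀ i, ∀ x : E3, 1 ≤ ‖x‖ → φ0 i x = 0 ∧ φ1 i x = 0) →
        (∀ i, H2norm (φ0 i) + H1norm (φ1 i) ≤ δ) →
        ∃ φ : Fin d → ℝ → E3 → ℝ,
          (∀ i, ContinuousOn (fun p : ℝ × E3 => φ i p.1 p.2) (Set.Ici 0 ×ˢ Set.univ)) ∧
          (∀ i t, Radial (φ i t)) ∧
          (∀ i, ∀ t r : ℝ, 0 ≤ t → 0 ≤ r →
            r * radRep (φ i t) r = psiLin (φ0 i) (φ1 i) t r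
              + (1 / 2) * ∫ p in Dreg t r,
                  (p.2 * ∑ j, a i j * |radRep (φ j p.1) p.2| ^ (c i j))) ∧
          ∃ ε : ℝ, ε ∈ Set.Ioo (0 : ℝ) 1 ∧ ∃ β : Fin d → ℝ, ∀ i, ∃ M : ℝ,
            ∀ (t : ℝ) (x : E3), 0 ≤ t →
              jap ((t + ‖x‖) / 2) ^ (1 - ε) * jap ((t - ‖x‖) / 2) ^ (β i) * |φ i t x| ≤ M := by
  obtain ⟨s, hs⟩ := exists_strict_exponents (P := fun i j => a i j ≠ 0) hc hεhat fun c' hc' => by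
    obtain ⟨s, hs⟩ := hpert c' hc'
    refine ⟨s, fun i j hij => ?_⟩
    rw [hs i]
    exact ciInf_le (Set.finite_range _).bddBelow (⟨j, hij⟩ : {j : Fin d // a i j ≠ 0})
  obtain ⟨ρ, hρ, hfix⟩ := exists_picard_fixedPoint hc hs
  have hA : 0 < √sphereArea := Real.sqrt_pos.2 sphereArea_pos
  set Q : ℝ := ∑ i, 3 ^ |s i| with hQ
  have hQ0 : 0 ≤ Q := Finset.sum_nonneg fun i _ => by positivity
  refine ⟨ρ * √sphereArea / (40 * (1 + Q)), by positivity, fun φ0 φ1 h0 h1 r0 r1 z hδ => ?_⟩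
  have d0 : ∀ i, ContDiff ℝ 2 (φ0 i) := fun i => contDiff_infty.1 (h0 i) 2
  have d1 : ∀ i, ContDiff ℝ 1 (φ1 i) := fun i => contDiff_infty.1 (h1 i) 1
  have d0' : ∀ i, ContDiff ℝ 1 (φ0 i) := fun i => contDiff_infty.1 (h0 i) 1
  have d1' : ∀ i, Continuous (φ1 i) := fun i => (h1 i).continuous
  have z0 : ∀ i x, 1 ≤ ‖x‖ → φ0 i x = 0 := fun i x hx => (z i x hx).1
  have z1 : ∀ i x, 1 ≤ ‖x‖ → φ1 i x = 0 := fun i x hx => (z i x hx).2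
  obtain ⟨f, hf, hfeq⟩ := hfix (fun i => linMean (φ0 i) (φ1 i))
    (fun i => continuous_linMean (d0' i) (d1' i))
    (fun i t r ht htr =>
      linMean_eq_zero_of_le (d0' i) (d1' i) (r0 i) (r1 i) (z0 i) (z1 i) ht htr)
    (fun i t r ht hr => by
      refine (abs_linMean_le (d0' i) (d1' i) (r0 i) (r1 i) (z0 i) (z1 i)
        (abs_linProfile_le (by positivity) (d0 i) (d1 i) (r0 i) (r1 i) (z0 i) (z1 i) (hδ i))
        (s i) ht hr).trans (mul_le_mul_of_nonneg_right ?_ (weight_pos _ _ _).le)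
      have hle : (3 : ℝ) ^ |s i| ≤ 1 + Q := by
        have := Finset.single_le_sum (f := fun i => (3 : ℝ) ^ |s i|)
          (fun i _ => by positivity) (Finset.mem_univ i)
        linarith
      calc 5 * 3 ^ |s i| * (4 * (ρ * √sphereArea / (40 * (1 + Q)) / √sphereArea))
          ≤ 5 * (1 + Q) * (4 * (ρ * √sphereArea / (40 * (1 + Q)) / √sphereArea)) := by gcongr
        _ = ρ / 2 := by field_simp; norm_num)
  refine ⟨fun i t x => weight (s i) t ‖x‖ * f i (t, ‖x‖), fun i => ?_, fun i t x y hxy => ?_,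
    fun i t r ht hr => ?_, 1 / 2, by norm_num, s, fun i => ⟨4 ^ |s i| * ρ, fun t x ht => ?_⟩⟩
  · have hp : Continuous fun p : ℝ × E3 => (p.1, ‖p.2‖) := by fun_prop
    exact (((continuous_weight (s i)).comp hp).mul ((f i).continuous.comp hp)).continuousOn
  · simp only [hxy]
  · have hrad : ∀ j t r, radRep (fun x => weight (s j) t ‖x‖ * f j (t, ‖x‖)) r
        = weight (s j) t r * f j (t, |r|) := fun j t r => by
      rw [radRep_comp_norm (fun r => weight (s j) t r * f j (t, r))]
      simp [weight]
    simp only [hrad]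
    rw [abs_of_nonneg hr, hfeq i t r ht hr, mul_picard_eq s hc _ f i ht hr,
      mul_linMean (d0' i) (d1' i) (r0 i) (r1 i)]
  · beta_reduce
    rcases le_or_gt (t + 1) ‖x‖ with htx | htx
    · rw [(hf i).2 t ‖x‖ ht htx, mul_zero, abs_zero, mul_zero]
      positivity
    · rw [show (1 : ℝ) - 1 / 2 = 1 / 2 by norm_num, abs_mul, abs_of_pos (weight_pos _ _ _),
        ← mul_assoc]
      exact mul_le_mul (jap_rpow_mul_weight_le (s i) ht (norm_nonneg x) htx.le)
        (((f i).norm_coe_le_norm _).trans (hf i).1) (abs_nonneg _) (by positivity)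

end
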